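/- arXiv:2107.05982 — 8 statements merged into one kernel-verified Lean document; each statement's English description precedes it below -/
import Mathlib

section
/- Let d ≥ 2 and let P, Q ∈ ℚ[z,w] be homogeneous polynomials of degree d that have a nonconstant common factor in ℚ[z,w] (equivalently, the homogeneous resultant of P and Q vanishes). Let F = (P,Q) : ℚ² → ℚ² and let A ∈ ℚ² be such that Fⁿ(A) ≠ (0,0) for every n ≥ 0. Then for every place v of ℚ, the limit α_v := lim_{n→∞} d^{−n} · log ‖Fⁿ(A)‖_v exists in ℝ. -/
open Filter Topology

/-- A sequence satisfying `s (n + 1) = d * s n` up to an error controlled by a sequence growing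
at most like `(d - 1) ^ n`, up to a subexponential factor, converges after division by `d ^ n`. -/
lemma exists_tendsto_inv_pow_mul_of_abs_sub_le (d : ℕ) (hd : 2 ≤ d) (s L : ℕ → ℝ) (B C E : ℝ)
    (hL : ∀ n, L (n + 1) ≤ (d - 1) * L n + C) (hE : 0 ≤ E)
    (hs : ∀ n, |s (n + 1) - d * s n| ≤ B + E * L n) :
    ∃ α : ℝ, Tendsto (fun n : ℕ => ((d : ℝ) ^ n)⁻¹ * s n) atTop (𝓝 α) := by
  have hd' : (2 : ℝ) ≤ d := by exact_mod_cast hd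
  set q : ℝ := d - 1 / 2 with hq
  have hq1 : 1 ≤ q := by linarith
  set K : ℝ := max (L 0) (max (2 * C) 0) with hK
  have hK0 : 0 ≤ K := (le_max_right _ _).trans (le_max_right _ _)
  have hKC : 2 * C ≤ K := (le_max_left _ _).trans (le_max_right _ _)
  have hgrowth : ∀ n, L n ≤ K * q ^ n := by
    intro n
    induction n with
    | zero => rw [pow_zero, mul_one]; exact le_max_left _ _
    | succ n ih =>
      have h1 : (1 : ℝ) ≤ q ^ n := one_le_pow₀ hq1
      have h2 : ((d : ℝ) - 1) * L n ≤ (d - 1) * (K * q ^ n) :=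
        mul_le_mul_of_nonneg_left ih (by linarith)
      have h3 : K ≤ K * q ^ n := le_mul_of_one_le_right hK0 h1
      have h4 : K * q ^ (n + 1) = (d - 1) * (K * q ^ n) + (K * q ^ n) / 2 := by
        rw [pow_succ, hq]; ring
      linarith [hL n]
  have hcauchy : CauchySeq (fun n : ℕ => ((d : ℝ) ^ n)⁻¹ * s n) := by
    refine cauchySeq_of_le_geometric (q / d) ((|B| + E * K) / d) ?_ ?_
    · rw [div_lt_one (by linarith)]; linarith
    intro n
    have hdn : (0 : ℝ) < d ^ (n + 1) := by positivity
    have h1 : (1 : ℝ) ≤ q ^ n := one_le_pow₀ hq1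
    have h2 : ((d : ℝ) ^ n)⁻¹ * s n - ((d : ℝ) ^ (n + 1))⁻¹ * s (n + 1)
        = -(((d : ℝ) ^ (n + 1))⁻¹ * (s (n + 1) - d * s n)) := by
      have : (d : ℝ) ≠ 0 := by linarith
      field_simp
      ring
    rw [Real.dist_eq, h2, abs_neg, abs_mul, abs_of_pos (inv_pos.2 hdn)]
    have h3 : |s (n + 1) - d * s n| ≤ (|B| + E * K) * q ^ n := by
      have := mul_le_mul_of_nonneg_left (hgrowth n) hE
      have h5 : |B| ≤ |B| * q ^ n := le_mul_of_one_le_right (abs_nonneg _) h1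
      linarith [hs n, le_abs_self B]
    calc ((d : ℝ) ^ (n + 1))⁻¹ * |s (n + 1) - d * s n|
        ≤ ((d : ℝ) ^ (n + 1))⁻¹ * ((|B| + E * K) * q ^ n) := by gcongr
      _ = (|B| + E * K) / d * (q / d) ^ n := by
        rw [div_pow, pow_succ]; field_simp
  exact cauchySeq_tendsto_of_complete hcauchy

lemma MvPolynomial.IsHomogeneous.degree_eq_of_mem_support {G : MvPolynomial (Fin 2) ℚ} {d : ℕ}
    (hG : G.IsHomogeneous d) {m : Fin 2 →₀ ℕ} (hm : m ∈ G.support) : m.degree = d := by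
  by_contra h
  exact MvPolynomial.mem_support_iff.1 hm (hG.coeff_eq_zero h)

lemma absoluteValue_intCast_le_abs (v : AbsoluteValue ℚ ℝ) (m : ℤ) : v m ≤ |(m : ℝ)| := by
  have h := v.apply_nat_le_self m.natAbs
  rwa [v.apply_natAbs_eq, Nat.cast_natAbs, Int.cast_abs] at h

/-- The sum of the absolute values of the coefficients controls the values of a polynomial. -/
lemma absoluteValue_eval_le (v : AbsoluteValue ℚ ℝ) (G : MvPolynomial (Fin 2) ℚ)
    (x : Fin 2 → ℚ) (M B : ℝ) (hx : ∀ i, v (x i) ≤ M)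
    (hB : ∀ m ∈ G.support, M ^ m.degree ≤ B) :
    v (G.eval x) ≤ (∑ m ∈ G.support, v (G.coeff m)) * B := by
  rw [MvPolynomial.eval_eq', Finset.sum_mul]
  refine (v.sum_le _ _).trans (Finset.sum_le_sum fun m hm => ?_)
  rw [map_mul, map_prod]
  refine mul_le_mul_of_nonneg_left (le_trans ?_ (hB m hm)) (v.nonneg _)
  rw [Finsupp.degree_eq_sum, ← Finset.prod_pow_eq_pow_sum]
  refine Finset.prod_le_prod (fun i _ => v.nonneg _) fun i _ => ?_
  rw [map_pow]
  exact pow_le_pow_left₀ (v.nonneg _) (hx i) _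

lemma exists_absoluteValue_eval_le_of_totalDegree_le (v : AbsoluteValue ℚ ℝ)
    (G : MvPolynomial (Fin 2) ℚ) (D : ℕ) (hG : G.totalDegree ≤ D) :
    ∃ c : ℝ, 1 ≤ c ∧ ∀ (x : Fin 2 → ℚ) (M : ℝ), 1 ≤ M → (∀ i, v (x i) ≤ M) →
      v (G.eval x) ≤ c * M ^ D := by
  refine ⟨max 1 (∑ m ∈ G.support, v (G.coeff m)), le_max_left _ _, fun x M hM hx => ?_⟩
  refine (absoluteValue_eval_le v G x M (M ^ D) hx fun m hm => ?_).trans ?_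
  · refine pow_le_pow_right₀ hM (le_trans ?_ hG)
    rw [Finsupp.degree_eq_sum, ← Finsupp.sum_fintype m (fun _ e => e) (fun _ => rfl)]
    exact MvPolynomial.le_totalDegree hm
  · exact mul_le_mul_of_nonneg_right (le_max_right _ _) (by positivity)

lemma exists_absoluteValue_eval_le_of_isHomogeneous (v : AbsoluteValue ℚ ℝ)
    (G : MvPolynomial (Fin 2) ℚ) (D : ℕ) (hG : G.IsHomogeneous D) :
    ∃ c : ℝ, 1 ≤ c ∧ ∀ (x : Fin 2 → ℚ) (M : ℝ), (∀ i, v (x i) ≤ M) →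
      v (G.eval x) ≤ c * M ^ D := by
  refine ⟨max 1 (∑ m ∈ G.support, v (G.coeff m)), le_max_left _ _, fun x M hx => ?_⟩
  have hM : 0 ≤ M := (v.nonneg _).trans (hx 0)
  refine (absoluteValue_eval_le v G x M (M ^ D) hx fun m hm => ?_).trans ?_
  · rw [hG.degree_eq_of_mem_support hm]
  · exact mul_le_mul_of_nonneg_right (le_max_right _ _) (by positivity)

/-- A nonzero integer clears the denominators of all values at integer points. -/
lemma exists_int_mul_eval_eq_int (G : MvPolynomial (Fin 2) ℚ) :
    ∃ N : ℤ, N ≠ 0 ∧ ∀ a : Fin 2 → ℤ, ∃ m : ℤ, (N : ℚ) * G.eval (fun i => (a i : ℚ)) = m := by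
  induction G using MvPolynomial.induction_on with
  | C r =>
    refine ⟨r.den, by simp, fun a => ⟨r.num, ?_⟩⟩
    simp [mul_comm]
  | add p q hp hq =>
    obtain ⟨N, hN, h⟩ := hp
    obtain ⟨N', hN', h'⟩ := hq
    refine ⟨N * N', mul_ne_zero hN hN', fun a => ?_⟩
    obtain ⟨m, hm⟩ := h a
    obtain ⟨m', hm'⟩ := h' a
    refine ⟨N' * m + N * m', ?_⟩
    push_cast
    rw [← hm, ← hm', map_add]
    ring
  | mul_X p i hp =>
    obtain ⟨N, hN, h⟩ := hp
    refine ⟨N, hN, fun a => ?_⟩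
    obtain ⟨m, hm⟩ := h a
    refine ⟨m * a i, ?_⟩
    push_cast
    rw [← hm, map_mul, MvPolynomial.eval_X]
    ring

/-- Liouville-type lower bound for nonvanishing values of a polynomial at integer points. -/
lemma exists_le_absoluteValue_eval (v : AbsoluteValue ℚ ℝ)
    (hv : ∀ m : ℤ, m ≠ 0 → 1 ≤ v m * |(m : ℝ)|)
    (G : MvPolynomial (Fin 2) ℚ) (D : ℕ) (hG : G.totalDegree ≤ D) :
    ∃ c : ℝ, 0 < c ∧ ∀ (a : Fin 2 → ℤ) (H : ℝ), 1 ≤ H → (∀ i, |(a i : ℝ)| ≤ H) →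
      G.eval (fun i => (a i : ℚ)) ≠ 0 → c ≤ v (G.eval fun i => (a i : ℚ)) * H ^ D := by
  obtain ⟨N, hN, hint⟩ := exists_int_mul_eval_eq_int G
  obtain ⟨c, hc, hbound⟩ :=
    exists_absoluteValue_eval_le_of_totalDegree_le Rat.AbsoluteValue.real G D hG
  have hN' : (N : ℚ) ≠ 0 := by exact_mod_cast hN
  have hvN : 0 < v N := v.pos hN'
  have hNr : 0 < |(N : ℝ)| := abs_pos.2 (by exact_mod_cast hN)
  refine ⟨(v N * |(N : ℝ)| * c)⁻¹, by positivity, fun a H hH ha hne => ?_⟩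
  obtain ⟨m, hm⟩ := hint a
  have hm0 : m ≠ 0 := by
    rintro rfl
    exact (mul_ne_zero hN' hne) (by simpa using hm)
  have h1 := hv m hm0
  have h2 := hbound (fun i => (a i : ℚ)) H hH (by simpa using ha)
  rw [Rat.AbsoluteValue.real_eq_abs] at h2
  have h3 : |(m : ℝ)| = |(N : ℝ)| * |((G.eval (fun i => (a i : ℚ)) : ℚ) : ℝ)| := by
    rw [← abs_mul]
    congr 1
    exact_mod_cast hm.symm
  push_cast at h2
  rw [← hm, map_mul, h3] at h1
  rw [inv_le_iff_one_le_mul₀ (by positivity)]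
  refine h1.trans ?_
  have := v.nonneg (G.eval fun i => (a i : ℚ))
  calc v N * v (G.eval fun i => (a i : ℚ)) *
        (|(N : ℝ)| * |((G.eval (fun i => (a i : ℚ)) : ℚ) : ℝ)|)
      ≤ v N * v (G.eval fun i => (a i : ℚ)) * (|(N : ℝ)| * (c * H ^ D)) := by gcongr
    _ = _ := by ring

/-- Every nonzero rational vector is proportional to a primitive integer vector. -/
lemma exists_eq_mul_primitive (x : Fin 2 → ℚ) (hx : x ≠ 0) :
    ∃ (r : ℚ) (a : Fin 2 → ℤ), r ≠ 0 ∧ IsCoprime (a 0) (a 1) ∧ ∀ i, x i = r * a i := by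
  have hd0 : ((x 0).den : ℚ) ≠ 0 := by exact_mod_cast (x 0).den_nz
  have hd1 : ((x 1).den : ℚ) ≠ 0 := by exact_mod_cast (x 1).den_nz
  set u : ℤ := (x 0).num * (x 1).den with hu
  set w : ℤ := (x 1).num * (x 0).den with hw
  have hxu : x 0 * ((x 0).den * (x 1).den) = u := by
    rw [← mul_assoc, Rat.mul_den_eq_num]; simp [hu]
  have hxw : x 1 * ((x 0).den * (x 1).den) = w := by
    rw [mul_comm ((x 0).den : ℚ), ← mul_assoc, Rat.mul_den_eq_num]; simp [hw]
  have hg : 0 < Int.gcd u w := by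
    rw [Int.gcd_pos_iff]
    by_contra! h
    refine hx (funext fun i => ?_)
    rw [h.1] at hxu
    rw [h.2] at hxw
    fin_cases i
    · simpa [hd0, hd1] using hxu
    · simpa [hd0, hd1] using hxw
  obtain ⟨a, b, hab, ha, hb⟩ := Int.exists_gcd_one hg
  refine ⟨Int.gcd u w / ((x 0).den * (x 1).den), ![a, b], by positivity,
    Int.isCoprime_iff_gcd_eq_one.2 (by simpa using hab), fun i => ?_⟩
  have ha' : (u : ℚ) = a * (Int.gcd u w : ℚ) := by exact_mod_cast ha
  have hb' : (w : ℚ) = b * (Int.gcd u w : ℚ) := by exact_mod_cast hb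
  rw [div_mul_eq_mul_div, eq_div_iff (mul_ne_zero hd0 hd1)]
  fin_cases i
  · exact hxu.trans (ha'.trans (mul_comm _ _))
  · exact hxw.trans (hb'.trans (mul_comm _ _))

/-- A primitive vector is the shortest among the nonzero integer vectors proportional to it. -/
lemma abs_le_abs_of_isCoprime_of_mul_eq_int (a m : Fin 2 → ℤ) (ha : IsCoprime (a 0) (a 1)) (s : ℚ)
    (hs : s ≠ 0) (h : ∀ i, s * a i = m i) (i : Fin 2) : |a i| ≤ |m i| := by
  obtain ⟨p, q, hpq⟩ := ha
  have hs' : s = ((p * m 0 + q * m 1 : ℤ) : ℚ) := by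
    have : (p : ℚ) * a 0 + q * a 1 = 1 := by exact_mod_cast hpq
    push_cast
    rw [← h, ← h]
    linear_combination -s * this
  generalize p * m 0 + q * m 1 = t at hs'
  subst hs'
  have ht : t ≠ 0 := by exact_mod_cast hs
  have hm : m i = t * a i := by exact_mod_cast (h i).symm
  rw [hm, abs_mul]
  exact le_mul_of_one_le_left (abs_nonneg _) (Int.one_le_abs ht)

/-- If `C` is a common divisor of `P` and `Q` of positive degree, then passing from a primitive
vector to a primitive vector proportional to its image under `(P, Q)` raises the height to the
power at most `d - 1`, up to a constant. -/
lemma exists_height_le (d : ℕ) (P Q : MvPolynomial (Fin 2) ℚ)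
    (hP : P.totalDegree ≤ d) (hQ : Q.totalDegree ≤ d)
    (hcommon : ∃ C : MvPolynomial (Fin 2) ℚ, 0 < C.totalDegree ∧ C ∣ P ∧ C ∣ Q) :
    ∃ c : ℝ, 1 ≤ c ∧ ∀ (a b : Fin 2 → ℤ) (s : ℚ) (H : ℝ), 1 ≤ H → (∀ i, |(a i : ℝ)| ≤ H) →
      IsCoprime (b 0) (b 1) → s ≠ 0 →
      P.eval (fun i => (a i : ℚ)) = s * b 0 → Q.eval (fun i => (a i : ℚ)) = s * b 1 →
      ∀ i, |(b i : ℝ)| ≤ c * H ^ (d - 1) := by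
  obtain ⟨C, hC, ⟨P₀, rfl⟩, ⟨Q₀, rfl⟩⟩ := hcommon
  have hC0 : C ≠ 0 := by rintro rfl; simp at hC
  have hdeg : ∀ G : MvPolynomial (Fin 2) ℚ, (C * G).totalDegree ≤ d → G.totalDegree ≤ d - 1 := by
    intro G hG
    rcases eq_or_ne G 0 with rfl | hG0
    · simp
    · rw [MvPolynomial.totalDegree_mul_of_isDomain hC0 hG0] at hG
      omega
  obtain ⟨N, hN, hNint⟩ := exists_int_mul_eval_eq_int P₀
  obtain ⟨N', hN', hNint'⟩ := exists_int_mul_eval_eq_int Q₀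
  obtain ⟨c, hc, hbound⟩ :=
    exists_absoluteValue_eval_le_of_totalDegree_le Rat.AbsoluteValue.real P₀ _ (hdeg _ hP)
  obtain ⟨c', hc', hbound'⟩ :=
    exists_absoluteValue_eval_le_of_totalDegree_le Rat.AbsoluteValue.real Q₀ _ (hdeg _ hQ)
  have hNN : (1 : ℝ) ≤ |((N * N' : ℤ) : ℝ)| := by
    exact_mod_cast Int.one_le_abs (mul_ne_zero hN hN')
  refine ⟨|((N * N' : ℤ) : ℝ)| * max c c',
    one_le_mul_of_one_le_of_one_le hNN (hc.trans (le_max_left _ _)), ?_⟩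
  intro a b s H hH ha hb hs hPa hQa
  obtain ⟨m, hm⟩ := hNint a
  obtain ⟨m', hm'⟩ := hNint' a
  set x : Fin 2 → ℚ := fun i => (a i : ℚ) with hx
  rw [map_mul] at hPa hQa
  have hCx : C.eval x ≠ 0 := by
    intro h0
    rw [h0, zero_mul, eq_comm, mul_eq_zero] at hPa hQa
    have h1 : b 0 = 0 := by simpa [hs] using hPa
    have h2 : b 1 = 0 := by simpa [hs] using hQa
    rw [h1, h2] at hb
    exact not_isCoprime_zero_zero hb
  have hN1 : (N : ℚ) ≠ 0 := by exact_mod_cast hN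
  have hN2 : (N' : ℚ) ≠ 0 := by exact_mod_cast hN'
  have h0 : N * N' * s / C.eval x * b 0 = ((N' * m : ℤ) : ℚ) := by
    push_cast
    rw [← hm]
    field_simp
    linear_combination -hPa
  have h1 : N * N' * s / C.eval x * b 1 = ((N * m' : ℤ) : ℚ) := by
    push_cast
    rw [← hm']
    field_simp
    linear_combination -hQa
  have key := abs_le_abs_of_isCoprime_of_mul_eq_int b ![N' * m, N * m'] hb
    (N * N' * s / C.eval x) (by positivity) (Fin.forall_fin_two.2 ⟨h0, h1⟩)
  have hB := hbound x H hH (by simpa [hx] using ha)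
  have hB' := hbound' x H hH (by simpa [hx] using ha)
  rw [Rat.AbsoluteValue.real_eq_abs] at hB hB'
  push_cast at hB hB'
  have e0 : ((N' * m : ℤ) : ℝ) = ((N * N' : ℤ) : ℝ) * ((P₀.eval x : ℚ) : ℝ) := by
    have : ((N' * m : ℤ) : ℚ) = ((N * N' : ℤ) : ℚ) * P₀.eval x := by
      push_cast; rw [← hm]; ring
    exact_mod_cast this
  have e1 : ((N * m' : ℤ) : ℝ) = ((N * N' : ℤ) : ℝ) * ((Q₀.eval x : ℚ) : ℝ) := by
    have : ((N * m' : ℤ) : ℚ) = ((N * N' : ℤ) : ℚ) * Q₀.eval x := by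
      push_cast; rw [← hm']; ring
    exact_mod_cast this
  have hHp : 0 ≤ H ^ (d - 1) := by positivity
  intro i
  fin_cases i
  · have k0 : |(b 0 : ℝ)| ≤ |((N' * m : ℤ) : ℝ)| := by exact_mod_cast key 0
    rw [e0, abs_mul] at k0
    refine k0.trans ?_
    rw [mul_assoc]
    gcongr
    exact hB.trans (mul_le_mul_of_nonneg_right (le_max_left _ _) hHp)
  · have k1 : |(b 1 : ℝ)| ≤ |((N * m' : ℤ) : ℝ)| := by exact_mod_cast key 1
    rw [e1, abs_mul] at k1
    refine k1.trans ?_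
    rw [mul_assoc]
    gcongr
    exact hB'.trans (mul_le_mul_of_nonneg_right (le_max_right _ _) hHp)

lemma MvPolynomial.IsHomogeneous.eval_mul_left {G : MvPolynomial (Fin 2) ℚ} {d : ℕ}
    (hG : G.IsHomogeneous d) (r : ℚ) (y : Fin 2 → ℚ) :
    G.eval (fun i => r * y i) = r ^ d * G.eval y := by
  rw [MvPolynomial.eval_eq', MvPolynomial.eval_eq', Finset.mul_sum]
  refine Finset.sum_congr rfl fun m hm => ?_
  simp only [mul_pow]
  rw [Finset.prod_mul_distrib, Finset.prod_pow_eq_pow_sum, ← Finsupp.degree_eq_sum,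
    hG.degree_eq_of_mem_support hm]
  ring

lemma max_apply_pos (v : AbsoluteValue ℚ ℝ) {x : Fin 2 → ℚ} (hx : x ≠ 0) :
    0 < max (v (x 0)) (v (x 1)) := by
  by_contra! h
  refine hx (funext fun i => ?_)
  have h0 := v.nonpos_iff.1 ((le_max_left _ _).trans h)
  have h1 := v.nonpos_iff.1 ((le_max_right _ _).trans h)
  fin_cases i
  · exact h0
  · exact h1

/-- The limit exists for every absolute value on `ℚ` satisfying a Liouville inequality at
nonzero integers. -/
theorem exists_tendsto_log_iterate (v : AbsoluteValue ℚ ℝ)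
    (hv : ∀ m : ℤ, m ≠ 0 → 1 ≤ v m * |(m : ℝ)|) (d : ℕ) (hd : 2 ≤ d)
    (P Q : MvPolynomial (Fin 2) ℚ)
    (hP : P.IsHomogeneous d) (hQ : Q.IsHomogeneous d)
    (hcommon : ∃ C : MvPolynomial (Fin 2) ℚ, 0 < C.totalDegree ∧ C ∣ P ∧ C ∣ Q)
    (F : (Fin 2 → ℚ) → (Fin 2 → ℚ))
    (hF : ∀ x, F x = ![MvPolynomial.eval x P, MvPolynomial.eval x Q])
    (A : Fin 2 → ℚ) (hA : ∀ n : ℕ, F^[n] A ≠ 0) :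
    ∃ α : ℝ, Tendsto (fun n : ℕ =>
      ((d : ℝ) ^ n)⁻¹ * Real.log (max (v ((F^[n] A) 0)) (v ((F^[n] A) 1)))) atTop (𝓝 α) := by
  set x : ℕ → Fin 2 → ℚ := fun n => F^[n] A with hx
  have hx0 : ∀ n, x (n + 1) 0 = P.eval (x n) := fun n => by
    simp [hx, Function.iterate_succ_apply', hF]
  have hx1 : ∀ n, x (n + 1) 1 = Q.eval (x n) := fun n => by
    simp [hx, Function.iterate_succ_apply', hF]
  choose r a hr ha hxa using fun n => exists_eq_mul_primitive (x n) (hA n)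
  set H : ℕ → ℝ := fun n => max |(a n 0 : ℝ)| |(a n 1 : ℝ)| with hH
  have haH : ∀ n i, |(a n i : ℝ)| ≤ H n := fun n i => by
    fin_cases i
    · exact le_max_left _ _
    · exact le_max_right _ _
  have hH1 : ∀ n, 1 ≤ H n := by
    intro n
    have : a n 0 ≠ 0 ∨ a n 1 ≠ 0 := by
      by_contra! h
      have := ha n
      rw [h.1, h.2] at this
      exact not_isCoprime_zero_zero this
    rcases this with h | h
    · exact le_trans (by exact_mod_cast Int.one_le_abs h) (haH n 0)
    · exact le_trans (by exact_mod_cast Int.one_le_abs h) (haH n 1)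
  have hxfun : ∀ n, x n = fun i => r n * (fun i => (a n i : ℚ)) i := fun n => funext (hxa n)
  have hPx : ∀ n, x (n + 1) 0 = r n ^ d * P.eval (fun i => (a n i : ℚ)) := fun n => by
    rw [hx0, hxfun n, hP.eval_mul_left]
  have hQx : ∀ n, x (n + 1) 1 = r n ^ d * Q.eval (fun i => (a n i : ℚ)) := fun n => by
    rw [hx1, hxfun n, hQ.eval_mul_left]
  obtain ⟨c, hc, hheight⟩ :=
    exists_height_le d P Q hP.totalDegree_le hQ.totalDegree_le hcommon
  have hHstep : ∀ n, H (n + 1) ≤ c * H n ^ (d - 1) := by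
    intro n
    have hrn := hr n
    have := hheight (a n) (a (n + 1)) (r (n + 1) / r n ^ d) (H n) (hH1 n) (haH n) (ha (n + 1))
      (div_ne_zero (hr _) (pow_ne_zero _ hrn))
      (by have := hPx n; rw [hxa] at this; field_simp; linarith)
      (by have := hQx n; rw [hxa] at this; field_simp; linarith)
    exact max_le (this 0) (this 1)
  obtain ⟨cP, hcP, hPle⟩ := exists_absoluteValue_eval_le_of_isHomogeneous v P d hP
  obtain ⟨cQ, hcQ, hQle⟩ := exists_absoluteValue_eval_le_of_isHomogeneous v Q d hQ
  obtain ⟨lP, hlP, hPge⟩ := exists_le_absoluteValue_eval v hv P d hP.totalDegree_le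
  obtain ⟨lQ, hlQ, hQge⟩ := exists_le_absoluteValue_eval v hv Q d hQ.totalDegree_le
  set S : ℕ → ℝ := fun n => max (v (x n 0)) (v (x n 1)) with hS
  have hSpos : ∀ n, 0 < S n := fun n => max_apply_pos v (hA n)
  have hxS : ∀ n i, v (x n i) ≤ S n := fun n i => by
    fin_cases i
    · exact le_max_left _ _
    · exact le_max_right _ _
  have hupper : ∀ n, S (n + 1) ≤ max cP cQ * S n ^ d := by
    intro n
    have hSd : 0 ≤ S n ^ d := (pow_pos (hSpos n) d).le
    refine max_le ?_ ?_
    · rw [hx0]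
      exact (hPle _ _ (hxS n)).trans (mul_le_mul_of_nonneg_right (le_max_left _ _) hSd)
    · rw [hx1]
      exact (hQle _ _ (hxS n)).trans (mul_le_mul_of_nonneg_right (le_max_right _ _) hSd)
  have hlower : ∀ n, min lP lQ * S n ^ d ≤ S (n + 1) * H n ^ (2 * d) := by
    intro n
    have hHn : 0 < H n := by linarith [hH1 n]
    have hSr : S n ≤ v (r n) * H n := by
      have : ∀ i, v (x n i) ≤ v (r n) * H n := fun i => by
        rw [hxa, map_mul]
        refine mul_le_mul_of_nonneg_left (le_trans ?_ (haH n i)) (v.nonneg _)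
        exact absoluteValue_intCast_le_abs v (a n i)
      exact max_le (this 0) (this 1)
    have hval : min lP lQ * v (r n) ^ d ≤ S (n + 1) * H n ^ d := by
      have hrd : 0 ≤ v (r n) ^ d := pow_nonneg (v.nonneg _) _
      have hne : P.eval (fun i => (a n i : ℚ)) ≠ 0 ∨ Q.eval (fun i => (a n i : ℚ)) ≠ 0 := by
        by_contra! h
        refine hA (n + 1) (funext fun i => ?_)
        have h0 := hPx n
        have h1 := hQx n
        rw [h.1, mul_zero] at h0
        rw [h.2, mul_zero] at h1
        fin_cases i
        · exact h0
        · exact h1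
      rcases hne with h | h
      · calc min lP lQ * v (r n) ^ d
            ≤ (v (P.eval fun i => (a n i : ℚ)) * H n ^ d) * v (r n) ^ d :=
              mul_le_mul_of_nonneg_right
                ((min_le_left _ _).trans (hPge _ _ (hH1 n) (haH n) h)) hrd
          _ = v (x (n + 1) 0) * H n ^ d := by rw [hPx, map_mul, map_pow]; ring
          _ ≤ S (n + 1) * H n ^ d := by gcongr; exact hxS _ _
      · calc min lP lQ * v (r n) ^ d
            ≤ (v (Q.eval fun i => (a n i : ℚ)) * H n ^ d) * v (r n) ^ d :=
              mul_le_mul_of_nonneg_right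
                ((min_le_right _ _).trans (hQge _ _ (hH1 n) (haH n) h)) hrd
          _ = v (x (n + 1) 1) * H n ^ d := by rw [hQx, map_mul, map_pow]; ring
          _ ≤ S (n + 1) * H n ^ d := by gcongr; exact hxS _ _
    calc min lP lQ * S n ^ d ≤ min lP lQ * (v (r n) * H n) ^ d :=
          mul_le_mul_of_nonneg_left (pow_le_pow_left₀ (hSpos n).le hSr d) (lt_min hlP hlQ).le
      _ = (min lP lQ * v (r n) ^ d) * H n ^ d := by ring
      _ ≤ (S (n + 1) * H n ^ d) * H n ^ d := by gcongr
      _ = S (n + 1) * H n ^ (2 * d) := by ring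
  have hl : 0 < min lP lQ := lt_min hlP hlQ
  have hu : 0 < max cP cQ := lt_max_of_lt_left (by linarith)
  refine exists_tendsto_inv_pow_mul_of_abs_sub_le d hd (fun n => Real.log (S n))
    (fun n => Real.log (H n)) (|Real.log (max cP cQ)| + |Real.log (min lP lQ)|) (Real.log c)
    (2 * d) ?_ (by positivity) ?_
  · intro n
    have hHn : 0 < H n := by linarith [hH1 n]
    have := Real.log_le_log (by linarith [hH1 (n + 1)]) (hHstep n)
    rw [Real.log_mul (by linarith) (by positivity), Real.log_pow,
      Nat.cast_sub (by omega), Nat.cast_one] at this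
    linarith
  · intro n
    have hHn : 0 < H n := by linarith [hH1 n]
    have hSn := hSpos n
    have hSn' := hSpos (n + 1)
    have h1 := Real.log_le_log hSn' (hupper n)
    rw [Real.log_mul hu.ne' (by positivity), Real.log_pow] at h1
    have h2 := Real.log_le_log (by positivity) (hlower n)
    rw [Real.log_mul hl.ne' (by positivity), Real.log_mul hSn'.ne' (by positivity),
      Real.log_pow, Real.log_pow] at h2
    push_cast at h2
    have h3 : 0 ≤ 2 * (d : ℝ) * Real.log (H n) := by
      have := Real.log_nonneg (hH1 n)
      positivity
    rw [abs_le]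
    constructor
    · linarith [neg_abs_le (Real.log (min lP lQ)), abs_nonneg (Real.log (max cP cQ))]
    · linarith [le_abs_self (Real.log (max cP cQ)), abs_nonneg (Real.log (min lP lQ))]

lemma one_le_padic_mul_abs (p : ℕ) [Fact p.Prime] (m : ℤ) (hm : m ≠ 0) :
    1 ≤ Rat.AbsoluteValue.padic p m * |(m : ℝ)| := by
  have hp : 0 < (p : ℝ) := by exact_mod_cast (Fact.out : p.Prime).pos
  have hdvd : p ^ padicValNat p m.natAbs ≤ m.natAbs :=
    Nat.le_of_dvd (Int.natAbs_pos.2 hm) pow_padicValNat_dvd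
  have hle : (p : ℝ) ^ padicValNat p m.natAbs ≤ |(m : ℝ)| := by
    rw [← Int.cast_abs, ← Nat.cast_natAbs]
    exact_mod_cast hdvd
  rw [Rat.AbsoluteValue.padic_eq_padicNorm,
    padicNorm.eq_zpow_of_nonzero (by exact_mod_cast hm), padicValRat.of_int, padicValInt,
    zpow_neg, zpow_natCast]
  push_cast
  rwa [inv_mul_eq_div, one_le_div (by positivity)]

/-- for a degenerate homogeneous pair `F = (P,Q)` of degree `d ≥ 2` over `ℚ`
(with a nonconstant common factor) and a point `A` whose `F`-orbit avoids `(0,0)`,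
the limit `α_v = lim d^{-n} log ‖Fⁿ(A)‖_v` exists at every place `v` of `ℚ`
(the archimedean place and every prime `p`). -/
theorem stmt_0 (d : ℕ) (hd : 2 ≤ d)
    (P Q : MvPolynomial (Fin 2) ℚ)
    (hP : P.IsHomogeneous d) (hQ : Q.IsHomogeneous d)
    (hcommon : ∃ C : MvPolynomial (Fin 2) ℚ, 0 < C.totalDegree ∧ C ∣ P ∧ C ∣ Q)
    (F : (Fin 2 → ℚ) → (Fin 2 → ℚ))
    (hF : ∀ x, F x = ![MvPolynomial.eval x P, MvPolynomial.eval x Q])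
    (A : Fin 2 → ℚ)
    (hA : ∀ n : ℕ, F^[n] A ≠ 0) :
    (∃ α : ℝ, Tendsto (fun n : ℕ =>
        ((d : ℝ) ^ n)⁻¹ * Real.log (max |(((F^[n] A) 0 : ℚ) : ℝ)| |(((F^[n] A) 1 : ℚ) : ℝ)|))
        atTop (𝓝 α)) ∧
    (∀ p : ℕ, p.Prime → ∃ α : ℝ, Tendsto (fun n : ℕ =>
        ((d : ℝ) ^ n)⁻¹ * Real.log (max (padicNorm p ((F^[n] A) 0) : ℝ)
          (padicNorm p ((F^[n] A) 1) : ℝ)))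
        atTop (𝓝 α)) := by
  constructor
  · obtain ⟨α, hα⟩ := exists_tendsto_log_iterate Rat.AbsoluteValue.real (fun m hm => by
      have h : (1 : ℝ) ≤ |(m : ℝ)| := by exact_mod_cast Int.one_le_abs hm
      simpa using one_le_mul_of_one_le_of_one_le h h) d hd P Q hP hQ hcommon F hF A hA
    exact ⟨α, by simpa using hα⟩
  · intro p hp
    have : Fact p.Prime := ⟨hp⟩
    exact exists_tendsto_log_iterate (Rat.AbsoluteValue.padic p) (one_le_padic_mul_abs p) d hd
      P Q hP hQ hcommon F hF A hA
end

section
/- Let d ≥ 2 and let P, Q ∈ ℚ[z,w] be homogeneous polynomials of degree d that have a nonconstant common factor in ℚ[z,w] (equivalently, the homogeneous resultant of P and Q vanishes). Let F = (P,Q) : ℚ² → ℚ² and let A ∈ ℚ² be such that Fⁿ(A) ≠ (0,0) for every n ≥ 0. For each place v of ℚ let α_v := lim_{n→∞} d^{−n} · log ‖Fⁿ(A)‖_v (these limits exist in ℝ). Then the sum over all primes p of |α_p| is finite; in particular the family (α_v) is an M_ℚ-quasiconstant, i.e. Σ_v |α_v| < ∞ where the sum runs over all primes together with the archimedean place. 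-/
open Filter Topology

instance Nat.Primes.fact_prime (p : Nat.Primes) : Fact (p : ℕ).Prime := ⟨p.2⟩

theorem padicNorm_le_one_of_not_dvd_den (p : ℕ) [Fact p.Prime] {q : ℚ} (h : ¬ p ∣ q.den) :
    padicNorm p q ≤ 1 := by
  have hden : padicNorm p (q.den : ℚ) = 1 := padicNorm.nat_eq_one_iff q.den |>.2 h
  rw [← Rat.num_div_den q, padicNorm.div, hden, div_one]
  exact padicNorm.of_int q.num

theorem Rat.exists_intCast_eq_of_padicNorm_le_one {q : ℚ}
    (h : ∀ p : Nat.Primes, padicNorm p q ≤ 1) : ∃ z : ℤ, (z : ℚ) = q := by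
  refine ⟨q.num, Rat.den_eq_one_iff q |>.1 ?_⟩
  by_contra hne
  obtain ⟨p, hp, hdvd⟩ := Nat.exists_prime_and_dvd hne
  have := Fact.mk hp
  have hnum : padicNorm p (q.num : ℚ) = 1 := by
    rw [padicNorm.int_eq_one_iff]
    intro hn
    have := Nat.dvd_gcd (Int.natCast_dvd.1 hn) hdvd
    rw [q.reduced.gcd_eq_one] at this
    exact hp.one_lt.ne' (Nat.dvd_one.1 this)
  have hden : padicNorm p (q.den : ℚ) < 1 := (padicNorm.nat_lt_one_iff q.den).2 hdvd
  have hpos : 0 < padicNorm p (q.den : ℚ) := by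
    refine lt_of_le_of_ne (padicNorm.nonneg _) (Ne.symm (padicNorm.nonzero ?_))
    exact_mod_cast q.den_nz
  have hq := h ⟨p, hp⟩
  rw [← Rat.num_div_den q, padicNorm.div] at hq
  simp only [hnum] at hq
  rw [div_le_one hpos] at hq
  linarith

theorem padicNorm_prod {ι : Type*} (p : ℕ) [Fact p.Prime] (s : Finset ι) (f : ι → ℚ) :
    padicNorm p (∏ i ∈ s, f i) = ∏ i ∈ s, padicNorm p (f i) := by
  classical
  induction s using Finset.induction_on with
  | empty => simp
  | insert a s ha ih => rw [Finset.prod_insert ha, Finset.prod_insert ha, padicNorm.mul, ih]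

theorem padicNorm_pow (p : ℕ) [Fact p.Prime] (q : ℚ) (n : ℕ) :
    padicNorm p (q ^ n) = padicNorm p q ^ n := by
  induction n with
  | zero => simp
  | succ n ih => rw [pow_succ, pow_succ, padicNorm.mul, ih]

theorem padicNorm_zpow_self (p : ℕ) [hp : Fact p.Prime] (k : ℤ) :
    padicNorm p ((p : ℚ) ^ k) = (p : ℚ) ^ (-k) := by
  have hp0 : (p : ℚ) ≠ 0 := by exact_mod_cast hp.out.ne_zero
  rw [padicNorm.eq_zpow_of_nonzero (zpow_ne_zero _ hp0), padicValRat.zpow]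
  simp [padicValRat.self hp.out.one_lt]

theorem padicNorm_zpow_of_ne {p l : ℕ} [hp : Fact p.Prime] [hl : Fact l.Prime] (h : p ≠ l)
    (k : ℤ) : padicNorm p ((l : ℚ) ^ k) = 1 := by
  have hl0 : (l : ℚ) ≠ 0 := by exact_mod_cast hl.out.ne_zero
  have hv : padicValRat p (l : ℚ) = 0 := by
    rw [padicValRat.of_nat, padicValNat_primes h]; rfl
  rw [padicNorm.eq_zpow_of_nonzero (zpow_ne_zero _ hl0), padicValRat.zpow, hv]
  simp

/-- One half of the product formula, with only finitely many primes involved. -/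
theorem one_le_abs_mul_prod_padicNorm {q : ℚ} (hq : q ≠ 0) (T : Finset Nat.Primes)
    (hT : ∀ p : Nat.Primes, p ∉ T → padicNorm p q ≤ 1) :
    1 ≤ |q| * ∏ p ∈ T, padicNorm p q := by
  have key : ∀ p l : Nat.Primes,
      padicNorm p (padicNorm l q) = if p = l then (padicNorm p q)⁻¹ else 1 := by
    intro p l
    rw [padicNorm.eq_zpow_of_nonzero (p := (l : ℕ)) hq]
    split_ifs with h
    · subst h
      rw [padicNorm_zpow_self, padicNorm.eq_zpow_of_nonzero hq, ← zpow_neg]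
    · exact padicNorm_zpow_of_ne (fun hpl => h (Subtype.ext hpl)) _
  have hne : ∏ p ∈ T, padicNorm p q ≠ 0 :=
    Finset.prod_ne_zero_iff.2 fun p _ => padicNorm.nonzero hq
  have hnn : 0 ≤ ∏ p ∈ T, padicNorm p q := Finset.prod_nonneg fun p _ => padicNorm.nonneg _
  obtain ⟨z, hz⟩ := Rat.exists_intCast_eq_of_padicNorm_le_one
      (q := q * ∏ p ∈ T, padicNorm p q) (by
    intro p
    rw [padicNorm.mul, padicNorm_prod]
    simp only [key, Finset.prod_ite_eq]
    split_ifs with h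
    · rw [mul_inv_cancel₀ (padicNorm.nonzero hq)]
    · simpa using hT p h)
  have hz0 : z ≠ 0 := by
    rintro rfl
    exact mul_ne_zero hq hne (by simpa using hz.symm)
  rw [← abs_of_nonneg hnn, ← abs_mul, ← hz]
  exact_mod_cast Int.one_le_abs hz0

theorem padicNorm_eval_le_one {σ : Type*} (p : ℕ) [Fact p.Prime] (f : MvPolynomial σ ℚ)
    (hf : ∀ m ∈ f.support, padicNorm p (f.coeff m) ≤ 1) (x : σ → ℚ)
    (hx : ∀ i, padicNorm p (x i) ≤ 1) : padicNorm p (MvPolynomial.eval x f) ≤ 1 := by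
  rw [MvPolynomial.eval_eq]
  refine padicNorm.sum_le' (fun m hm => ?_) zero_le_one
  rw [padicNorm.mul, padicNorm_prod]
  refine mul_le_one₀ (hf m hm) (Finset.prod_nonneg fun i _ => padicNorm.nonneg _)
    (Finset.prod_le_one (fun i _ => padicNorm.nonneg _) fun i _ => ?_)
  rw [padicNorm_pow]
  exact pow_le_one₀ (padicNorm.nonneg _) (hx i)

theorem finite_setOf_one_lt_padicNorm (q : ℚ) :
    {p : Nat.Primes | ¬ padicNorm p q ≤ 1}.Finite := by
  refine Set.Finite.of_finite_image (f := fun p : Nat.Primes => (p : ℕ))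
    (q.den.primeFactors.finite_toSet.subset ?_) Subtype.val_injective.injOn
  rintro _ ⟨p, hp, rfl⟩
  refine Nat.mem_primeFactors.2 ⟨p.2, ?_, q.den_nz⟩
  by_contra h
  exact hp (padicNorm_le_one_of_not_dvd_den p h)

/-- Outside a finite set of primes, the whole orbit of a point under a polynomial self-map
is integral. -/
theorem exists_finset_forall_padicNorm_iterate_le_one
    (P Q : MvPolynomial (Fin 2) ℚ) (F : (Fin 2 → ℚ) → (Fin 2 → ℚ))
    (hF : ∀ x, F x = ![MvPolynomial.eval x P, MvPolynomial.eval x Q]) (A : Fin 2 → ℚ) :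
    ∃ B : Finset Nat.Primes, ∀ p : Nat.Primes, p ∉ B → ∀ n i, padicNorm p ((F^[n] A) i) ≤ 1 := by
  have hcoeff (f : MvPolynomial (Fin 2) ℚ) :
      {p : Nat.Primes | ∃ m ∈ f.support, ¬ padicNorm p (f.coeff m) ≤ 1}.Finite := by
    refine (f.support.finite_toSet.biUnion fun m _ =>
      finite_setOf_one_lt_padicNorm (f.coeff m)).subset ?_
    rintro p ⟨m, hm, h⟩
    exact Set.mem_biUnion (Finset.mem_coe.2 hm) h
  have hpoint : {p : Nat.Primes | ∃ i, ¬ padicNorm p (A i) ≤ 1}.Finite := by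
    rw [Set.ofPred_exists]
    exact Set.finite_iUnion fun i => finite_setOf_one_lt_padicNorm (A i)
  refine ⟨(((hcoeff P).union (hcoeff Q)).union hpoint).toFinset, fun p hp n => ?_⟩
  simp only [Set.Finite.mem_toFinset, Set.mem_union, Set.mem_ofPred_eq, not_or, not_exists,
    not_and, not_not] at hp
  obtain ⟨⟨hP, hQ⟩, hA⟩ := hp
  induction n with
  | zero => simpa using hA
  | succ n ih =>
    rw [Function.iterate_succ_apply', hF]
    intro i
    fin_cases i
    · exact padicNorm_eval_le_one p P hP _ ih
    · exact padicNorm_eval_le_one p Q hQ _ ih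

/-- The logarithmic height of a nonzero vector, taken over enough places, is nonnegative. -/
theorem log_max_abs_add_sum_log_max_padicNorm_nonneg {x : Fin 2 → ℚ} (hx : x ≠ 0)
    (T : Finset Nat.Primes) (hT : ∀ p : Nat.Primes, p ∉ T → ∀ i, padicNorm p (x i) ≤ 1) :
    0 ≤ Real.log (max |((x 0 : ℚ) : ℝ)| |((x 1 : ℚ) : ℝ)|) +
      ∑ p ∈ T, Real.log (max (padicNorm p (x 0) : ℝ) (padicNorm p (x 1) : ℝ)) := by
  obtain ⟨i, hi⟩ := Function.ne_iff.1 hx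
  replace hi : x i ≠ 0 := hi
  have habs : |((x i : ℚ) : ℝ)| ≤ max |((x 0 : ℚ) : ℝ)| |((x 1 : ℚ) : ℝ)| := by
    fin_cases i <;> simp
  have hpad (p : Nat.Primes) :
      (padicNorm p (x i) : ℝ) ≤ max (padicNorm p (x 0) : ℝ) (padicNorm p (x 1) : ℝ) := by
    fin_cases i <;> simp
  have hpos (p : Nat.Primes) : 0 < (padicNorm p (x i) : ℝ) := by
    exact_mod_cast lt_of_le_of_ne (padicNorm.nonneg _) (Ne.symm (padicNorm.nonzero hi))
  have hapos : 0 < |((x i : ℚ) : ℝ)| := abs_pos.2 (by exact_mod_cast hi)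
  have hone : (1 : ℝ) ≤ |((x i : ℚ) : ℝ)| * ∏ p ∈ T, (padicNorm p (x i) : ℝ) := by
    exact_mod_cast one_le_abs_mul_prod_padicNorm hi T fun p hp => hT p hp i
  calc (0 : ℝ) ≤ Real.log (|((x i : ℚ) : ℝ)| * ∏ p ∈ T, (padicNorm p (x i) : ℝ)) :=
        Real.log_nonneg hone
    _ = Real.log |((x i : ℚ) : ℝ)| + ∑ p ∈ T, Real.log (padicNorm p (x i) : ℝ) := by
        rw [Real.log_mul hapos.ne' (Finset.prod_ne_zero_iff.2 fun p _ => (hpos p).ne'),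
          Real.log_prod fun p _ => (hpos p).ne']
    _ ≤ _ := add_le_add (Real.log_le_log hapos habs)
        (Finset.sum_le_sum fun p _ => Real.log_le_log (hpos p) (hpad p))

/-- in the setting of Statement 0, the escape-rate limits
`α_v = lim d^{-n} log ‖Fⁿ(A)‖_v` form an `M_ℚ`-quasiconstant: the sum of `|α_p|`
over all primes `p` (together with the single archimedean value `α_∞`) is finite. -/
theorem stmt_1 (d : ℕ) (hd : 2 ≤ d)
    (P Q : MvPolynomial (Fin 2) ℚ)
    (hP : P.IsHomogeneous d) (hQ : Q.IsHomogeneous d)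
    (hcommon : ∃ C : MvPolynomial (Fin 2) ℚ, 0 < C.totalDegree ∧ C ∣ P ∧ C ∣ Q)
    (F : (Fin 2 → ℚ) → (Fin 2 → ℚ))
    (hF : ∀ x, F x = ![MvPolynomial.eval x P, MvPolynomial.eval x Q])
    (A : Fin 2 → ℚ)
    (hA : ∀ n : ℕ, F^[n] A ≠ 0)
    (αinf : ℝ) (α : ℕ → ℝ)
    (hαinf : Tendsto (fun n : ℕ =>
        ((d : ℝ) ^ n)⁻¹ * Real.log (max |(((F^[n] A) 0 : ℚ) : ℝ)| |(((F^[n] A) 1 : ℚ) : ℝ)|))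
        atTop (𝓝 αinf))
    (hα : ∀ p : ℕ, p.Prime → Tendsto (fun n : ℕ =>
        ((d : ℝ) ^ n)⁻¹ * Real.log (max (padicNorm p ((F^[n] A) 0) : ℝ)
          (padicNorm p ((F^[n] A) 1) : ℝ)))
        atTop (𝓝 (α p))) :
    Summable (fun p : Nat.Primes => |α (p : ℕ)|) := by
  classical
  obtain ⟨B, hB⟩ := exists_finset_forall_padicNorm_iterate_le_one P Q F hF A
  have hnonpos (p : Nat.Primes) (hp : p ∉ B) : α p ≤ 0 := by
    refine le_of_tendsto' (hα p p.2) fun n => ?_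
    refine mul_nonpos_of_nonneg_of_nonpos (by positivity) (Real.log_nonpos ?_ ?_)
    · exact le_max_of_le_left (by exact_mod_cast padicNorm.nonneg _)
    · exact max_le (by exact_mod_cast hB p hp n 0) (by exact_mod_cast hB p hp n 1)
  have hheight (T : Finset Nat.Primes) (hBT : B ⊆ T) : 0 ≤ αinf + ∑ p ∈ T, α p := by
    refine ge_of_tendsto' (hαinf.add (tendsto_finsetSum T fun p _ => hα p p.2)) fun n => ?_
    rw [← Finset.mul_sum, ← mul_add]
    exact mul_nonneg (by positivity) (log_max_abs_add_sum_log_max_padicNorm_nonneg (hA n) T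
      fun p hp => hB p (fun h => hp (hBT h)) n)
  refine summable_of_sum_le (c := αinf + ∑ p ∈ B, (|α p| + α p)) (fun p => abs_nonneg _)
    fun S => ?_
  have hBT : B ⊆ S ∪ B := Finset.subset_union_right
  have hbad : ∑ p ∈ B, (|α p| + α p) = ∑ p ∈ S ∪ B, (|α p| + α p) :=
    Finset.sum_subset hBT fun p _ hp => by rw [abs_of_nonpos (hnonpos p hp), neg_add_cancel]
  have hmono : ∑ p ∈ S, |α p| ≤ ∑ p ∈ S ∪ B, |α p| :=
    Finset.sum_le_sum_of_subset_of_nonneg Finset.subset_union_left fun p _ _ => abs_nonneg _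
  have := hheight _ hBT
  rw [hbad, Finset.sum_add_distrib]
  linarith
end

section
/- Let p be a prime, let d ≥ 2, and let P, Q be polynomials in variables z, w, homogeneous of degree d in (z, w), with coefficients in the polynomial ring ℚ[t]. For t₀ ∈ ℚ_p let F_{t₀} = (P_{t₀}, Q_{t₀}) : ℚ_p² → ℚ_p² denote the map obtained by evaluating all coefficients at t = t₀. Let A ∈ (ℚ[t])², and for n ≥ 0 let Fⁿ(A) ∈ (ℚ[t])² denote the n-th iterate of F = (P,Q) applied to A within (ℚ[t])². Assume: (i) not all coefficients of P and Q vanish at t = 0; (ii) P₀ and Q₀ have a common zero in ℂ² ∖ {(0,0)}, but for some t* ∈ ℂ, P_{t*} and Q_{t*} have no common zero in ℂ² ∖ {(0,0)}; (iii) F₀ⁿ(A(0)) ≠ (0,0) for all n ≥ 0. Then there exist δ > 0 and a continuous function g : {t ∈ ℚ_p : |t|_p < δ} → ℝ such that (Fⁿ(A))(t) ≠ (0,0) for every n ≥ 0 and every t ∈ ℚ_p with |t|_p < δ, and the functions g_n(t) := d^{−n}·log ‖(Fⁿ(A))(t)‖_p converge uniformly to g on {t ∈ ℚ_p : |t|_p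 < δ}, where ‖(z,w)‖_p = max(|z|_p, |w|_p) and |·|_p is the p-adic absolute value on ℚ_p normalized so that |p|_p = 1/p. -/
open Filter Topology

/-- The specialization `F_{t₀} : ℚ_p² → ℚ_p²` of a pair of bivariate polynomials with
coefficients in `ℚ[t]`, obtained by evaluating all coefficients at `t = t₀ ∈ ℚ_p`. -/
noncomputable def specQp (p : ℕ) [Fact p.Prime]
    (P Q : MvPolynomial (Fin 2) (Polynomial ℚ)) (t₀ : ℚ_[p]) :
    (Fin 2 → ℚ_[p]) → (Fin 2 → ℚ_[p]) :=
  fun x => ![MvPolynomial.eval₂ (Polynomial.aeval t₀).toRingHom x P,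
             MvPolynomial.eval₂ (Polynomial.aeval t₀).toRingHom x Q]

/-- The map `F = (P,Q)` acting on `(ℚ[t])²`. -/
noncomputable def polyMapQp (P Q : MvPolynomial (Fin 2) (Polynomial ℚ)) :
    (Fin 2 → Polynomial ℚ) → (Fin 2 → Polynomial ℚ) :=
  fun x => ![MvPolynomial.eval x P, MvPolynomial.eval x Q]

theorem MvPolynomial.IsHomogeneous.apply_zero_add_apply_one {R : Type*} [CommSemiring R] {d : ℕ}
    {P : MvPolynomial (Fin 2) R} (hP : P.IsHomogeneous d) {m : Fin 2 →₀ ℕ} (hm : m ∈ P.support) :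
    m 0 + m 1 = d := by
  have := hP (MvPolynomial.mem_support_iff.mp hm)
  simpa [Finsupp.weight_apply, Finsupp.sum_fintype, Fin.sum_univ_two] using this

theorem MvPolynomial.IsHomogeneous.eval₂_smul {R S : Type*} [CommSemiring R] [CommSemiring S]
    {d : ℕ} {P : MvPolynomial (Fin 2) R} (hP : P.IsHomogeneous d) (φ : R →+* S) (c : S)
    (x : Fin 2 → S) :
    MvPolynomial.eval₂ φ (c • x) P = c ^ d * MvPolynomial.eval₂ φ x P := by
  rw [MvPolynomial.eval₂_eq', MvPolynomial.eval₂_eq', Finset.mul_sum]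
  refine Finset.sum_congr rfl fun m hm => ?_
  rw [← hP.apply_zero_add_apply_one hm]
  simp only [Fin.prod_univ_two, Pi.smul_apply, smul_eq_mul]
  ring

/-- `Approx r M a b` : `a` and `b` have size at most `M` and differ by at most `r * M`. -/
def Approx {K : Type*} [NormedRing K] (r M : ℝ) (a b : K) : Prop :=
  ‖a‖ ≤ M ∧ ‖b‖ ≤ M ∧ ‖a - b‖ ≤ r * M

namespace Approx

variable {K : Type*} [NormedField K] {r M N : ℝ} {a b a' b' : K}

theorem zero : Approx r 0 (0 : K) 0 := by simp [Approx]

theorem const (hr : 0 ≤ r) (a : K) : Approx r ‖a‖ a a := by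
  simp [Approx]; positivity

theorem add (h : Approx r M a b) (h' : Approx r N a' b') :
    Approx r (M + N) (a + a') (b + b') := by
  refine ⟨norm_add_le_of_le h.1 h'.1, norm_add_le_of_le h.2.1 h'.2.1, ?_⟩
  rw [add_sub_add_comm, mul_add]
  exact norm_add_le_of_le h.2.2 h'.2.2

theorem sum {ι : Type*} (s : Finset ι) {M : ι → ℝ} {a b : ι → K}
    (h : ∀ i ∈ s, Approx r (M i) (a i) (b i)) :
    Approx r (∑ i ∈ s, M i) (∑ i ∈ s, a i) (∑ i ∈ s, b i) := by
  classical
  induction s using Finset.induction_on with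
  | empty => simpa using zero
  | insert i s hi ih =>
    simp only [Finset.sum_insert hi]
    exact (h i (by simp)).add (ih fun j hj => h j (by simp [hj]))

variable [IsUltrametricDist K]

theorem mul (h : Approx r M a b) (h' : Approx r N a' b') :
    Approx r (M * N) (a * a') (b * b') := by
  have hM : 0 ≤ M := (norm_nonneg _).trans h.1
  have hN : 0 ≤ N := (norm_nonneg _).trans h'.1
  refine ⟨?_, ?_, ?_⟩
  · rw [norm_mul]; exact mul_le_mul h.1 h'.1 (norm_nonneg _) hM
  · rw [norm_mul]; exact mul_le_mul h.2.1 h'.2.1 (norm_nonneg _) hM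
  · have e : a * a' - b * b' = a * (a' - b') + (a - b) * b' := by ring
    rw [e]
    refine (IsUltrametricDist.norm_add_le_max _ _).trans (max_le ?_ ?_)
    · rw [norm_mul]
      calc ‖a‖ * ‖a' - b'‖ ≤ M * (r * N) := mul_le_mul h.1 h'.2.2 (norm_nonneg _) hM
        _ = _ := by ring
    · rw [norm_mul]
      calc ‖a - b‖ * ‖b'‖ ≤ (r * M) * N :=
            mul_le_mul h.2.2 h'.2.1 (norm_nonneg _) ((norm_nonneg _).trans h.2.2)
        _ = _ := by ring

theorem pow (hr : 0 ≤ r) (h : Approx r M a b) (n : ℕ) : Approx r (M ^ n) (a ^ n) (b ^ n) := by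
  induction n with
  | zero => simpa using const hr (1 : K)
  | succ n ih => simpa only [pow_succ] using ih.mul h

theorem aeval [Algebra ℚ K] (f : Polynomial ℚ) : ∃ C : ℝ, 0 ≤ C ∧
    ∀ (r : ℝ) (t : K), r ≤ 1 → ‖t‖ ≤ r →
      Approx r C (Polynomial.aeval t f) (Polynomial.aeval (0 : K) f) := by
  induction f using Polynomial.induction_on' with
  | add f g hf hg =>
    obtain ⟨C, hC, hf⟩ := hf
    obtain ⟨D, hD, hg⟩ := hg
    refine ⟨C + D, by positivity, fun r t hr ht => ?_⟩
    simpa using (hf r t hr ht).add (hg r t hr ht)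
  | monomial n a =>
    refine ⟨‖algebraMap ℚ K a‖ * 1 ^ n, by positivity, fun r t hr ht => ?_⟩
    have h0 : 0 ≤ r := (norm_nonneg _).trans ht
    have hX : Approx r 1 t 0 := ⟨ht.trans hr, by simp, by simpa using ht⟩
    simpa only [Polynomial.aeval_monomial] using (const h0 (algebraMap ℚ K a)).mul (hX.pow h0 n)

theorem eval₂_form [Algebra ℚ K] {d : ℕ} {P : MvPolynomial (Fin 2) (Polynomial ℚ)}
    (hP : P.IsHomogeneous d) : ∃ C : ℝ, 0 ≤ C ∧
    ∀ (r M : ℝ) (t : K) (x y : Fin 2 → K), r ≤ 1 → ‖t‖ ≤ r → (∀ i, Approx r M (x i) (y i)) →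
      Approx r (C * M ^ d) (MvPolynomial.eval₂ (Polynomial.aeval t).toRingHom x P)
        (MvPolynomial.eval₂ (Polynomial.aeval (0 : K)).toRingHom y P) := by
  choose C hC h using fun f : Polynomial ℚ => aeval (K := K) f
  refine ⟨∑ m ∈ P.support, C (P.coeff m), Finset.sum_nonneg fun _ _ => hC _,
    fun r M t x y hr ht hxy => ?_⟩
  have h0 : 0 ≤ r := (norm_nonneg _).trans ht
  rw [MvPolynomial.eval₂_eq', MvPolynomial.eval₂_eq', Finset.sum_mul]
  refine sum _ fun m hm => ?_
  have hd : m 0 + m 1 = d := hP.apply_zero_add_apply_one hm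
  rw [Fin.prod_univ_two, Fin.prod_univ_two, ← hd, pow_add]
  exact (h _ r t hr ht).mul (((hxy 0).pow h0 _).mul ((hxy 1).pow h0 _))

end Approx

theorem norm_int_form_le {e : ℕ} {U : MvPolynomial (Fin 2) ℤ} (hU : U.IsHomogeneous e) :
    ∃ C : ℝ, 0 ≤ C ∧ ∀ (b : Fin 2 → ℤ) (B : ℝ), (∀ i, |(b i : ℝ)| ≤ B) →
      |((MvPolynomial.eval b U : ℤ) : ℝ)| ≤ C * B ^ e := by
  refine ⟨∑ m ∈ U.support, |((U.coeff m : ℤ) : ℝ)|, Finset.sum_nonneg fun _ _ => abs_nonneg _,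
    fun b B hb => ?_⟩
  rw [MvPolynomial.eval_eq', Finset.sum_mul, Int.cast_sum]
  refine (Finset.abs_sum_le_sum_abs _ _).trans (Finset.sum_le_sum fun m hm => ?_)
  have hd : m 0 + m 1 = e := hU.apply_zero_add_apply_one hm
  have hB : 0 ≤ B := (abs_nonneg _).trans (hb 0)
  push_cast
  rw [Fin.prod_univ_two, ← hd, pow_add, abs_mul, abs_mul, abs_pow, abs_pow]
  have h0 := pow_le_pow_left₀ (abs_nonneg _) (hb 0) (m 0)
  have h1 := pow_le_pow_left₀ (abs_nonneg _) (hb 1) (m 1)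
  gcongr

theorem MvPolynomial.exists_int_multiple {σ : Type*} (f : MvPolynomial σ ℚ) :
    ∃ (N : ℤ) (g : MvPolynomial σ ℤ), N ≠ 0 ∧
      MvPolynomial.map (Int.castRingHom ℚ) g = MvPolynomial.C (N : ℚ) * f := by
  induction f using MvPolynomial.induction_on with
  | C a =>
    refine ⟨a.den, MvPolynomial.C a.num, by simp, ?_⟩
    rw [MvPolynomial.map_C, ← map_mul]
    congr 1
    simp
  | add f g hf hg =>
    obtain ⟨N, f', hN, hf⟩ := hf
    obtain ⟨M, g', hM, hg⟩ := hg
    refine ⟨N * M, MvPolynomial.C M * f' + MvPolynomial.C N * g', mul_ne_zero hN hM, ?_⟩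
    rw [map_add, map_mul, map_mul, MvPolynomial.map_C, MvPolynomial.map_C, hf, hg, Int.cast_mul,
      map_mul, eq_intCast, eq_intCast]
    ring
  | mul_X f i hf =>
    obtain ⟨N, f', hN, hf⟩ := hf
    exact ⟨N, f' * MvPolynomial.X i, hN, by simp [hf, mul_assoc]⟩

theorem natDegree_aeval_X_one_le {R : Type*} [CommRing R] {d : ℕ} {P : MvPolynomial (Fin 2) R}
    (hP : P.IsHomogeneous d) :
    (MvPolynomial.aeval ![Polynomial.X, (1 : Polynomial R)] P).natDegree ≤ d := by
  rw [MvPolynomial.aeval_def, MvPolynomial.eval₂_eq']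
  refine Polynomial.natDegree_sum_le_of_forall_le _ _ fun m hm => ?_
  have hd : m 0 + m 1 = d := hP.apply_zero_add_apply_one hm
  simp only [Fin.prod_univ_two, Matrix.cons_val_zero, Matrix.cons_val_one, one_pow, mul_one]
  refine (Polynomial.natDegree_C_mul_X_pow_le _ _).trans (by omega)

theorem exists_form_of_isHomogeneous {R : Type*} [CommRing R] {d : ℕ} {P : MvPolynomial (Fin 2) R}
    (hP : P.IsHomogeneous d) :
    ∃ u : Polynomial R, u.natDegree ≤ d ∧ u.homogenize d = P :=
  ⟨_, natDegree_aeval_X_one_le hP, Polynomial.homogenize_eq_of_isHomogeneous hP rfl⟩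

theorem eval_homogenize_of_eq_zero {R : Type*} [CommRing R] (u : Polynomial R) (d : ℕ)
    (x : Fin 2 → R) (hx : x 1 = 0) :
    MvPolynomial.eval x (u.homogenize d) = u.coeff d * x 0 ^ d := by
  rw [Polynomial.homogenize, map_sum, Finset.sum_eq_single (d, 0)]
  · simp [MvPolynomial.eval_monomial, Finsupp.prod_fintype]
  · rintro ⟨k, l⟩ hkl hne
    have : l ≠ 0 := by
      rintro rfl
      simp_all
    simp [MvPolynomial.eval_monomial, Finsupp.prod_fintype, hx, this]
  · simp

theorem exists_common_factor {d : ℕ} (hd : 1 ≤ d) {P Q : MvPolynomial (Fin 2) ℚ}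
    (hP : P.IsHomogeneous d) (hQ : Q.IsHomogeneous d) (hne : ¬(P = 0 ∧ Q = 0))
    (x : Fin 2 → ℂ) (hx : x ≠ 0) (hPx : MvPolynomial.aeval x P = 0)
    (hQx : MvPolynomial.aeval x Q = 0) :
    ∃ (e : ℕ) (G U V : MvPolynomial (Fin 2) ℚ), e < d ∧ G.IsHomogeneous (d - e) ∧
      U.IsHomogeneous e ∧ V.IsHomogeneous e ∧ P = G * U ∧ Q = G * V := by
  obtain ⟨u, hu, rfl⟩ := exists_form_of_isHomogeneous hP
  obtain ⟨v, hv, rfl⟩ := exists_form_of_isHomogeneous hQ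
  rw [MvPolynomial.aeval_def, ← MvPolynomial.eval_map, ← Polynomial.homogenize_map] at hPx hQx
  by_cases hx1 : x 1 = 0
  · have hx0 : x 0 ≠ 0 := by
      intro h
      apply hx
      ext i
      fin_cases i <;> simpa
    have key : ∀ w : Polynomial ℚ, w.natDegree ≤ d →
        MvPolynomial.eval x ((w.map (algebraMap ℚ ℂ)).homogenize d) = 0 →
        w.homogenize d = MvPolynomial.X 1 * w.homogenize (d - 1) := by
      intro w hw h
      rw [eval_homogenize_of_eq_zero _ _ _ hx1] at h
      have hc : w.coeff d = 0 := by simpa [hx0] using h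
      have hw' : w.natDegree ≤ d - 1 := by
        rw [Polynomial.natDegree_le_iff_coeff_eq_zero]
        intro N hN
        rcases (show d = N ∨ d < N by omega) with rfl | h
        · exact hc
        · exact Polynomial.coeff_eq_zero_of_natDegree_lt (hw.trans_lt h)
      have := Polynomial.homogenize_mul 1 w (m := 1) (n := d - 1) (by simp) hw'
      rwa [one_mul, Nat.add_sub_cancel' hd, Polynomial.homogenize_one, pow_one] at this
    exact ⟨d - 1, _, _, _, by omega,
      by rw [Nat.sub_sub_self hd]; exact MvPolynomial.isHomogeneous_X _ _,
      Polynomial.isHomogeneous_homogenize _, Polynomial.isHomogeneous_homogenize _,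
      key u hu hPx, key v hv hQx⟩
  · have root : ∀ w : Polynomial ℚ, w.natDegree ≤ d →
        MvPolynomial.eval x ((w.map (algebraMap ℚ ℂ)).homogenize d) = 0 →
        Polynomial.aeval (x 0 / x 1) w = 0 := by
      intro w hw h
      rw [Polynomial.eval_homogenize (Polynomial.natDegree_map_le.trans hw) _ hx1,
        Polynomial.eval_map_algebraMap] at h
      simpa [hx1] using h
    obtain ⟨w, hw0, hwd, hw⟩ : ∃ w : Polynomial ℚ, w ≠ 0 ∧ w.natDegree ≤ d ∧
        Polynomial.aeval (x 0 / x 1) w = 0 := by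
      by_cases hu0 : u = 0
      · exact ⟨v, fun h => hne (by simp [hu0, h]), hv, root v hv hQx⟩
      · exact ⟨u, hu0, hu, root u hu hPx⟩
    have hint : IsIntegral ℚ (x 0 / x 1) := IsAlgebraic.isIntegral ⟨w, hw0, hw⟩
    set h := minpoly ℚ (x 0 / x 1)
    have hh0 : h ≠ 0 := minpoly.ne_zero hint
    have hpos : 0 < h.natDegree := minpoly.natDegree_pos hint
    have hle : h.natDegree ≤ d :=
      (Polynomial.natDegree_le_of_dvd (minpoly.dvd _ _ hw) hw0).trans hwd
    have key : ∀ w : Polynomial ℚ, w.natDegree ≤ d → Polynomial.aeval (x 0 / x 1) w = 0 →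
        ∃ w' : Polynomial ℚ, w.homogenize d =
          h.homogenize h.natDegree * w'.homogenize (d - h.natDegree) := by
      intro w hwd hw
      obtain ⟨w', rfl⟩ : h ∣ w := minpoly.dvd _ _ hw
      refine ⟨w', ?_⟩
      have hdeg : w'.natDegree ≤ d - h.natDegree := by
        by_cases hw' : w' = 0
        · simp [hw']
        · rw [Polynomial.natDegree_mul hh0 hw'] at hwd
          omega
      rw [← Polynomial.homogenize_mul _ _ le_rfl hdeg, Nat.add_sub_cancel' hle]
    obtain ⟨u', hu'⟩ := key u hu (root u hu hPx)
    obtain ⟨v', hv'⟩ := key v hv (root v hv hQx)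
    exact ⟨d - h.natDegree, _, _, _, by omega,
      by rw [Nat.sub_sub_self hle]; exact Polynomial.isHomogeneous_homogenize _,
      Polynomial.isHomogeneous_homogenize _, Polynomial.isHomogeneous_homogenize _, hu', hv'⟩

theorem resultant_ne_zero_of_natDegree_eq {d : ℕ} {f g : Polynomial ℂ} (hf : f.natDegree = d)
    (hg : g.natDegree ≤ d) (hf0 : f ≠ 0)
    (h : ∀ z, ¬(f.eval z = 0 ∧ g.eval z = 0)) : f.resultant g d d ≠ 0 := by
  have := Polynomial.resultant_eq_prod_eval f g d hg (IsAlgClosed.splits f)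
  rw [hf] at this
  rw [this]
  refine mul_ne_zero (pow_ne_zero _ (by simpa using hf0)) (Multiset.prod_ne_zero fun h0 => ?_)
  obtain ⟨z, hz, hz'⟩ := Multiset.mem_map.mp h0
  exact h z ⟨(Polynomial.mem_roots'.mp hz).2, hz'⟩

theorem exists_bezout_form {d : ℕ} (hd : 1 ≤ d) {P Q : MvPolynomial (Fin 2) (Polynomial ℚ)}
    (hP : P.IsHomogeneous d) (hQ : Q.IsHomogeneous d) (tstar : ℂ)
    (hgood : ∀ x : Fin 2 → ℂ, x ≠ 0 →
        ¬(MvPolynomial.eval₂ (Polynomial.aeval tstar).toRingHom x P = 0 ∧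
          MvPolynomial.eval₂ (Polynomial.aeval tstar).toRingHom x Q = 0)) :
    ∃ (R : Polynomial ℚ) (a b : MvPolynomial (Fin 2) (Polynomial ℚ)), R ≠ 0 ∧
      a.IsHomogeneous (d - 1) ∧ b.IsHomogeneous (d - 1) ∧
      P * a + Q * b = MvPolynomial.C R * MvPolynomial.X 1 ^ (d + (d - 1)) := by
  obtain ⟨u, hu, rfl⟩ := exists_form_of_isHomogeneous hP
  obtain ⟨v, hv, rfl⟩ := exists_form_of_isHomogeneous hQ
  obtain ⟨a, b, ha, hb, hab⟩ :=
    Polynomial.exists_mul_add_mul_eq_C_resultant (m := d) (n := d) u v hu hv (by omega)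
  have ha' : a.natDegree ≤ d - 1 := by
    rcases eq_or_ne a 0 with rfl | h
    · simp
    · have := (Polynomial.natDegree_lt_iff_degree_lt h).mpr ha; omega
  have hb' : b.natDegree ≤ d - 1 := by
    rcases eq_or_ne b 0 with rfl | h
    · simp
    · have := (Polynomial.natDegree_lt_iff_degree_lt h).mpr hb; omega
  refine ⟨u.resultant v d d, a.homogenize (d - 1), b.homogenize (d - 1), ?_,
    Polynomial.isHomogeneous_homogenize _, Polynomial.isHomogeneous_homogenize _, ?_⟩
  · intro h0
    set φ : Polynomial ℚ →+* ℂ := (Polynomial.aeval tstar).toRingHom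
    have h1 := Polynomial.resultant_map_map u v d d φ
    rw [h0, map_zero] at h1
    simp only [← MvPolynomial.eval_map, ← Polynomial.homogenize_map] at hgood
    have hfd : (u.map φ).natDegree ≤ d := Polynomial.natDegree_map_le.trans hu
    have hgd : (v.map φ).natDegree ≤ d := Polynomial.natDegree_map_le.trans hv
    have hroot : ∀ z, ¬((u.map φ).eval z = 0 ∧ (v.map φ).eval z = 0) := by
      rintro z ⟨hz, hz'⟩
      refine hgood ![z, 1] (fun h => by simpa using congrFun h 1) ?_
      rw [Polynomial.eval_homogenize hfd _ (by simp), Polynomial.eval_homogenize hgd _ (by simp)]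
      simp [hz, hz']
    have hlead := hgood ![1, 0] (fun h => by simpa using congrFun h 0)
    rw [eval_homogenize_of_eq_zero _ _ _ (by simp), eval_homogenize_of_eq_zero _ _ _ (by simp)]
      at hlead
    have hdeg : ∀ w : Polynomial ℂ, w.natDegree ≤ d → w.coeff d ≠ 0 → w.natDegree = d :=
      fun w hw hc => le_antisymm hw (Polynomial.le_natDegree_of_ne_zero hc)
    by_cases hc : (u.map φ).coeff d = 0
    · have hc' : (v.map φ).coeff d ≠ 0 := fun h => hlead (by simp [hc, h])
      refine resultant_ne_zero_of_natDegree_eq (hdeg _ hgd hc') hfd (fun h => hc' (by simp [h]))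
        (fun z hz => hroot z hz.symm) ?_
      rw [Polynomial.resultant_comm, h1, mul_zero]
    · exact resultant_ne_zero_of_natDegree_eq (hdeg _ hfd hc) hgd (fun h => hc (by simp [h]))
        hroot h1
  · rw [← Polynomial.homogenize_mul _ _ hu ha', ← Polynomial.homogenize_mul _ _ hv hb',
      ← Polynomial.homogenize_add, hab, Polynomial.homogenize_C]

/-- A sequence of continuous functions with uniformly summable increments converges uniformly to
a continuous limit. -/
theorem exists_tendstoUniformlyOn_of_summable {α : Type*} [TopologicalSpace α] {s : Set α}
    {f : ℕ → α → ℝ} (hf : ∀ n, ContinuousOn (f n) s) {u : ℕ → ℝ} (hu : Summable u)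
    (hfu : ∀ n, ∀ t ∈ s, |f (n + 1) t - f n t| ≤ u n) :
    ∃ g : α → ℝ, ContinuousOn g s ∧ TendstoUniformlyOn f g atTop s := by
  have h := tendstoUniformlyOn_tsum_nat hu (f := fun n t => f (n + 1) t - f n t) hfu
  have hlim : TendstoUniformlyOn f (fun t => f 0 t + ∑' n, (f (n + 1) t - f n t)) atTop s := by
    rw [Metric.tendstoUniformlyOn_iff] at h ⊢
    intro ε hε
    filter_upwards [h ε hε] with n hn t ht
    have := hn t ht
    rw [Finset.sum_range_sub (fun n => f n t), Real.dist_eq] at this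
    rw [Real.dist_eq]
    convert this using 2
    ring
  exact ⟨_, hlim.continuousOn (Frequently.of_forall hf), hlim⟩

section Orbit

variable {K V : Type*} [NormedField K] [NormedAddCommGroup V]
  {d : ℕ} {F : K → V → V} {x : ℕ → K → V} {C D ρ : ℝ}

/-- A radius within which the `n`-th orbit point stays close to the one at the parameter `0`. -/
noncomputable def closeRadius (d : ℕ) (ρ D : ℝ) (n : ℕ) : ℝ :=
  ρ * Real.exp (-(D * (n ^ 2 * ((d - 1 : ℕ) : ℝ) ^ n)))

theorem closeRadius_pos (hρ : 0 < ρ) (n : ℕ) : 0 < closeRadius d ρ D n := by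
  unfold closeRadius; positivity

theorem closeRadius_le (hρ : 0 < ρ) (hD : 0 ≤ D) (n : ℕ) : closeRadius d ρ D n ≤ ρ :=
  mul_le_of_le_one_right hρ.le (Real.exp_le_one_iff.mpr (neg_nonpos.mpr (by positivity)))

theorem closeRadius_succ_le (hd : 2 ≤ d) (hρ : 0 < ρ) (hD : 0 ≤ D) (n : ℕ) :
    closeRadius d ρ D (n + 1) ≤
      closeRadius d ρ D n * Real.exp (-(D * ((n + 1) * ((d - 1 : ℕ) : ℝ) ^ n))) := by
  unfold closeRadius
  rw [mul_assoc, ← Real.exp_add]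
  have hE : (1 : ℝ) ≤ ((d - 1 : ℕ) : ℝ) := by exact_mod_cast (by omega : 1 ≤ d - 1)
  refine mul_le_mul_of_nonneg_left (Real.exp_le_exp.mpr ?_) hρ.le
  rw [← neg_add, neg_le_neg_iff, ← mul_add]
  refine mul_le_mul_of_nonneg_left ?_ hD
  rw [← add_mul]
  push_cast
  have hpow := pow_le_pow_right₀ hE (Nat.le_succ n)
  refine mul_le_mul ?_ hpow (by positivity) (by positivity)
  nlinarith [Nat.cast_nonneg (α := ℝ) n]

theorem closeRadius_antitone_succ (hd : 2 ≤ d) (hρ : 0 < ρ) (hD : 0 ≤ D) (n : ℕ) :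
    closeRadius d ρ D (n + 1) ≤ closeRadius d ρ D n :=
  (closeRadius_succ_le hd hρ hD n).trans <| mul_le_of_le_one_right (closeRadius_pos hρ n).le
    (Real.exp_le_one_iff.mpr (neg_nonpos.mpr (by positivity)))

theorem orbit_ne_zero (hx : ∀ n t, x (n + 1) t = F t (x n t)) {c : ℝ} {m : ℕ} (hc : 0 < c)
    {t : K} (ht : t ≠ 0) (hlower : ∀ v : V, c * ‖t‖ ^ m * ‖v‖ ^ d ≤ ‖F t v‖) (h0 : x 0 t ≠ 0)
    (n : ℕ) : x n t ≠ 0 := by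
  induction n with
  | zero => exact h0
  | succ n ih =>
    rw [hx, ← norm_pos_iff]
    have := norm_pos_iff.mpr ih
    have := norm_pos_iff.mpr ht
    exact lt_of_lt_of_le (by positivity) (hlower _)

variable [IsUltrametricDist V]

theorem norm_eq_of_norm_sub_lt {u v : V} (h : ‖u - v‖ < ‖v‖) : ‖u‖ = ‖v‖ := by
  have := IsUltrametricDist.norm_add_eq_max_of_norm_ne_norm h.ne
  rwa [sub_add_cancel, max_eq_right h.le] at this

theorem norm_orbit_sub_le (hd : 2 ≤ d) (hx : ∀ n t, x (n + 1) t = F t (x n t))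
    (hF : ∀ (r M : ℝ) (t : K) (u v : V), r ≤ 1 → ‖t‖ ≤ r → ‖u‖ ≤ M → ‖v‖ ≤ M → ‖u - v‖ ≤ r * M →
      ‖F t u - F 0 v‖ ≤ Real.exp C * r * M ^ d)
    (hne : ∀ n, x n 0 ≠ 0) (hC : 0 ≤ C) (hD : 0 ≤ D) (hρ : 0 < ρ) (hρ1 : ρ ≤ 1)
    (hlow : ∀ n : ℕ, Real.exp (-(D * ((n + 1) * ((d - 1 : ℕ) : ℝ) ^ n))) * ‖x n 0‖ ^ d ≤
      ‖x (n + 1) 0‖)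
    (h0 : ∀ t, ‖t‖ < ρ → ‖x 0 t - x 0 0‖ ≤ ‖t‖ / ρ * ‖x 0 0‖) (n : ℕ) (t : K)
    (ht : ‖t‖ < closeRadius d ρ (C + D) n) :
    ‖x n t - x n 0‖ ≤ ‖t‖ / closeRadius d ρ (C + D) n * ‖x n 0‖ := by
  have hCD : 0 ≤ C + D := by positivity
  have hE : (1 : ℝ) ≤ ((d - 1 : ℕ) : ℝ) := by exact_mod_cast (by omega : 1 ≤ d - 1)
  induction n with
  | zero =>
    have : closeRadius d ρ (C + D) 0 = ρ := by simp [closeRadius]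
    rw [this] at ht ⊢
    exact h0 t ht
  | succ n ih =>
    have ht' := ht.trans_le (closeRadius_antitone_succ hd hρ hCD n)
    have ih := ih ht'
    have hpos : 0 < closeRadius d ρ (C + D) n := closeRadius_pos hρ n
    have hpos' : 0 < closeRadius d ρ (C + D) (n + 1) := closeRadius_pos hρ (n + 1)
    have hle1 : closeRadius d ρ (C + D) n ≤ 1 := (closeRadius_le hρ hCD n).trans hρ1
    have hxpos : 0 < ‖x n 0‖ := norm_pos_iff.mpr (hne n)
    have hr : ‖t‖ / closeRadius d ρ (C + D) n < 1 := (div_lt_one hpos).mpr ht'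
    have hnorm : ‖x n t‖ = ‖x n 0‖ :=
      norm_eq_of_norm_sub_lt (ih.trans_lt (mul_lt_of_lt_one_left hxpos hr))
    have hstep := hF _ ‖x n 0‖ t (x n t) (x n 0) hr.le
      (le_div_self (norm_nonneg _) hpos hle1) hnorm.le le_rfl ih
    rw [← hx, ← hx] at hstep
    refine hstep.trans ?_
    set T : ℝ := (n + 1) * ((d - 1 : ℕ) : ℝ) ^ n with hT
    have hT1 : 1 ≤ T := one_le_mul_of_one_le_of_one_le
      (by linarith [Nat.cast_nonneg (α := ℝ) n]) (one_le_pow₀ hE)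
    have hsucc : closeRadius d ρ (C + D) (n + 1) ≤
        closeRadius d ρ (C + D) n * Real.exp (-((C + D) * T)) :=
      closeRadius_succ_le hd hρ hCD n
    have hpow : ‖x n 0‖ ^ d ≤ Real.exp (D * T) * ‖x (n + 1) 0‖ := by
      have := mul_le_mul_of_nonneg_left (hlow n) (Real.exp_pos (D * T)).le
      rwa [← mul_assoc, ← Real.exp_add, add_neg_cancel, Real.exp_zero, one_mul] at this
    have hexp : Real.exp C * Real.exp (D * T) ≤ Real.exp ((C + D) * T) := by
      rw [← Real.exp_add]
      refine Real.exp_le_exp.mpr ?_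
      nlinarith
    have hrad : Real.exp ((C + D) * T) / closeRadius d ρ (C + D) n ≤
        1 / closeRadius d ρ (C + D) (n + 1) := by
      rw [div_le_div_iff₀ hpos hpos', one_mul]
      calc _ ≤ Real.exp ((C + D) * T) *
            (closeRadius d ρ (C + D) n * Real.exp (-((C + D) * T))) := by gcongr
        _ = closeRadius d ρ (C + D) n * Real.exp ((C + D) * T + -((C + D) * T)) := by
            rw [Real.exp_add]; ring
        _ = _ := by simp
    calc Real.exp C * (‖t‖ / closeRadius d ρ (C + D) n) * ‖x n 0‖ ^ d
        ≤ Real.exp C * (‖t‖ / closeRadius d ρ (C + D) n) *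
          (Real.exp (D * T) * ‖x (n + 1) 0‖) := by gcongr
      _ = (Real.exp C * Real.exp (D * T)) / closeRadius d ρ (C + D) n * (‖t‖ * ‖x (n + 1) 0‖) := by
          ring
      _ ≤ 1 / closeRadius d ρ (C + D) (n + 1) * (‖t‖ * ‖x (n + 1) 0‖) := by
          refine mul_le_mul_of_nonneg_right (le_trans ?_ hrad) (by positivity)
          exact div_le_div_of_nonneg_right hexp hpos.le
      _ = _ := by ring

theorem norm_orbit_eq (hd : 2 ≤ d) (hx : ∀ n t, x (n + 1) t = F t (x n t))
    (hF : ∀ (r M : ℝ) (t : K) (u v : V), r ≤ 1 → ‖t‖ ≤ r → ‖u‖ ≤ M → ‖v‖ ≤ M → ‖u - v‖ ≤ r * M →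
      ‖F t u - F 0 v‖ ≤ Real.exp C * r * M ^ d)
    (hne : ∀ n, x n 0 ≠ 0) (hC : 0 ≤ C) (hD : 0 ≤ D) (hρ : 0 < ρ) (hρ1 : ρ ≤ 1)
    (hlow : ∀ n : ℕ, Real.exp (-(D * ((n + 1) * ((d - 1 : ℕ) : ℝ) ^ n))) * ‖x n 0‖ ^ d ≤
      ‖x (n + 1) 0‖)
    (h0 : ∀ t, ‖t‖ < ρ → ‖x 0 t - x 0 0‖ ≤ ‖t‖ / ρ * ‖x 0 0‖) (n : ℕ) (t : K)
    (ht : ‖t‖ < closeRadius d ρ (C + D) n) : ‖x n t‖ = ‖x n 0‖ :=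
  norm_eq_of_norm_sub_lt <|
    (norm_orbit_sub_le hd hx hF hne hC hD hρ hρ1 hlow h0 n t ht).trans_lt <|
      mul_lt_of_lt_one_left (norm_pos_iff.mpr (hne n)) ((div_lt_one (closeRadius_pos hρ n)).mpr ht)

/-- If `a ^ d * exp (-L) ≤ b ≤ a ^ d * exp L`, then the normalized logarithms of `a` and `b` are
close. -/
theorem abs_log_sub_log_le {a b L : ℝ} (hd : 0 < d) (ha : 0 < a) (n : ℕ)
    (hl : Real.exp (-L) * a ^ d ≤ b) (hu : b ≤ Real.exp L * a ^ d) :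
    |((d : ℝ) ^ (n + 1))⁻¹ * Real.log b - ((d : ℝ) ^ n)⁻¹ * Real.log a| ≤
      L / (d : ℝ) ^ (n + 1) := by
  have hd' : (0 : ℝ) < d := by exact_mod_cast hd
  have had : 0 < a ^ d := by positivity
  have hb : 0 < b := lt_of_lt_of_le (by positivity) hl
  have h1 := Real.log_le_log (by positivity) hl
  have h2 := Real.log_le_log hb hu
  rw [Real.log_mul (Real.exp_ne_zero _) had.ne', Real.log_exp, Real.log_pow] at h1 h2
  have e : ((d : ℝ) ^ (n + 1))⁻¹ * Real.log b - ((d : ℝ) ^ n)⁻¹ * Real.log a =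
      (Real.log b - d * Real.log a) / (d : ℝ) ^ (n + 1) := by
    field_simp
    ring
  rw [e, abs_div, abs_of_pos (pow_pos hd' (n + 1))]
  gcongr
  rw [abs_le]
  constructor <;> linarith

theorem summable_sq_mul_geometric (hd : 2 ≤ d) (B : ℝ) :
    Summable fun n : ℕ =>
      B * (((n + 1 : ℕ) : ℝ) ^ 2 * (((d - 1 : ℕ) : ℝ) / d) ^ (n + 1)) := by
  have hd' : (0 : ℝ) < d := by exact_mod_cast (by omega : 0 < d)
  have hr : ‖((d - 1 : ℕ) : ℝ) / d‖ < 1 := by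
    rw [Real.norm_of_nonneg (by positivity), div_lt_one hd']
    exact_mod_cast (by omega : d - 1 < d)
  generalize ((d - 1 : ℕ) : ℝ) / d = q at hr ⊢
  exact ((summable_nat_add_iff (f := fun n : ℕ => (n : ℝ) ^ 2 * q ^ n) 1).mpr
    (summable_pow_mul_geometric_of_norm_lt_one 2 hr)).mul_left B

/-- The normalized logarithms along an orbit have uniformly summable increments near `t = 0`. -/
theorem exists_summable_increment_bound (hd : 2 ≤ d) (hx : ∀ n t, x (n + 1) t = F t (x n t))
    (hF : ∀ (r M : ℝ) (t : K) (u v : V), r ≤ 1 → ‖t‖ ≤ r → ‖u‖ ≤ M → ‖v‖ ≤ M → ‖u - v‖ ≤ r * M →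
      ‖F t u - F 0 v‖ ≤ Real.exp C * r * M ^ d)
    (hFle : ∀ (t : K) (u : V), ‖t‖ ≤ 1 → ‖F t u‖ ≤ Real.exp C * ‖u‖ ^ d)
    (hne : ∀ n, x n 0 ≠ 0) (hC : 0 ≤ C) (hD : 0 ≤ D)
    (hlow : ∀ n : ℕ, Real.exp (-(D * ((n + 1) * ((d - 1 : ℕ) : ℝ) ^ n))) * ‖x n 0‖ ^ d ≤
      ‖x (n + 1) 0‖) (hρ : 0 < ρ) (hρ1 : ρ ≤ 1)
    (h0 : ∀ t, ‖t‖ < ρ → ‖x 0 t - x 0 0‖ ≤ ‖t‖ / ρ * ‖x 0 0‖)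
    {c : ℝ} {m : ℕ} (hc : 0 < c)
    (hlower : ∀ (t : K) (v : V), ‖t‖ < ρ → c * ‖t‖ ^ m * ‖v‖ ^ d ≤ ‖F t v‖) :
    (∀ n t, ‖t‖ < ρ → x n t ≠ 0) ∧
    ∃ u : ℕ → ℝ, Summable u ∧ ∀ n t, ‖t‖ < ρ →
      |((d : ℝ) ^ (n + 1))⁻¹ * Real.log ‖x (n + 1) t‖ - ((d : ℝ) ^ n)⁻¹ * Real.log ‖x n t‖| ≤
        u n := by
  have hnz : ∀ n t, ‖t‖ < ρ → x n t ≠ 0 := by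
    intro n t ht
    rcases eq_or_ne t 0 with rfl | ht0
    · exact hne n
    · refine orbit_ne_zero hx hc ht0 (fun v => hlower t v ht) ?_ n
      rw [← norm_pos_iff, norm_orbit_eq hd hx hF hne hC hD hρ hρ1 hlow h0 0 t
        (by simpa [closeRadius] using ht), norm_pos_iff]
      exact hne 0
  refine ⟨hnz, _, summable_sq_mul_geometric hd
    (C + D + |Real.log c| + m * (-Real.log ρ) + m * (C + D)), fun n t ht => ?_⟩
  have hd0 : (0 : ℝ) < d := by exact_mod_cast (by omega : 0 < d)
  have hE : (1 : ℝ) ≤ ((d - 1 : ℕ) : ℝ) := by exact_mod_cast (by omega : 1 ≤ d - 1)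
  have hCD : 0 ≤ C + D := by positivity
  have hlogρ : 0 ≤ -Real.log ρ := neg_nonneg.mpr (Real.log_nonpos hρ.le hρ1)
  set W : ℝ := ((n + 1 : ℕ) : ℝ) ^ 2 * ((d - 1 : ℕ) : ℝ) ^ (n + 1) with hW
  have hn1 : (1 : ℝ) ≤ ((n + 1 : ℕ) : ℝ) := by exact_mod_cast Nat.le_add_left 1 n
  have hW1 : 1 ≤ W := one_le_mul_of_one_le_of_one_le (one_le_pow₀ hn1) (one_le_pow₀ hE)
  have hTW : ((n : ℝ) + 1) * ((d - 1 : ℕ) : ℝ) ^ n ≤ W := by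
    refine mul_le_mul ?_ (pow_le_pow_right₀ hE n.le_succ) (by positivity) (by positivity)
    push_cast at hn1 ⊢
    nlinarith
  set L : ℝ := (C + D + |Real.log c| + m * (-Real.log ρ) + m * (C + D)) * W with hL
  have hrhs : (C + D + |Real.log c| + m * (-Real.log ρ) + m * (C + D)) *
      (((n + 1 : ℕ) : ℝ) ^ 2 * (((d - 1 : ℕ) : ℝ) / d) ^ (n + 1)) = L / (d : ℝ) ^ (n + 1) := by
    rw [hL, hW, div_pow]; ring
  have hnn1 : 0 ≤ |Real.log c| := abs_nonneg _
  have hnn2 : 0 ≤ m * (-Real.log ρ) := by positivity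
  have hnn3 : 0 ≤ m * (C + D) := by positivity
  have hCL : C ≤ L := by
    nlinarith
  have hDL : D * ((n + 1) * ((d - 1 : ℕ) : ℝ) ^ n) ≤ L := by
    calc _ ≤ D * W := by gcongr
      _ ≤ _ := by rw [hL]; gcongr; linarith
  rw [hrhs]
  have hupper : ‖x (n + 1) t‖ ≤ Real.exp L * ‖x n t‖ ^ d := by
    rw [hx]
    refine (hFle t _ (ht.le.trans hρ1)).trans ?_
    gcongr
  refine abs_log_sub_log_le (by omega) (norm_pos_iff.mpr (hnz n t ht)) n ?_ hupper
  by_cases htn : ‖t‖ < closeRadius d ρ (C + D) (n + 1)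
  · rw [norm_orbit_eq hd hx hF hne hC hD hρ hρ1 hlow h0 (n + 1) t htn,
      norm_orbit_eq hd hx hF hne hC hD hρ hρ1 hlow h0 n t
        (htn.trans_le (closeRadius_antitone_succ hd hρ hCD n))]
    refine le_trans ?_ (hlow n)
    gcongr
  · rw [hx]
    refine le_trans ?_ (hlower t _ ht)
    gcongr
    have hrpos := closeRadius_pos (d := d) (D := C + D) hρ (n + 1)
    have hlogr : Real.log (closeRadius d ρ (C + D) (n + 1)) = Real.log ρ - (C + D) * W := by
      rw [closeRadius, Real.log_mul hρ.ne' (Real.exp_ne_zero _), Real.log_exp]; ring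
    have htpos : 0 < ‖t‖ := hrpos.trans_le (not_lt.mp htn)
    rw [← Real.le_log_iff_exp_le (by positivity), Real.log_mul hc.ne' (by positivity), Real.log_pow]
    have h1 := Real.log_le_log hrpos (not_lt.mp htn)
    rw [hlogr] at h1
    have h2 : (m : ℝ) * (Real.log ρ - (C + D) * W) ≤ m * Real.log ‖t‖ := by gcongr
    have h3 := neg_abs_le (Real.log c)
    have h4 : |Real.log c| ≤ |Real.log c| * W := le_mul_of_one_le_right hnn1 hW1
    have h5 : m * (-Real.log ρ) ≤ m * (-Real.log ρ) * W := le_mul_of_one_le_right hnn2 hW1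
    have h6 : 0 ≤ (C + D) * W := by positivity
    rw [hL]
    linarith

end Orbit

theorem norm_fin_two {K : Type*} [NormedRing K] (x : Fin 2 → K) : ‖x‖ = max ‖x 0‖ ‖x 1‖ := by
  refine le_antisymm ((pi_norm_le_iff_of_nonneg (by positivity)).mpr fun i => ?_)
    (max_le (norm_le_pi_norm x 0) (norm_le_pi_norm x 1))
  fin_cases i <;> simp

theorem exists_lower_bound_aeval {K : Type*} [NormedField K] [Algebra ℚ K] {R : Polynomial ℚ}
    (hR : R ≠ 0) : ∃ (c : ℝ) (m : ℕ) (δ : ℝ), 0 < c ∧ 0 < δ ∧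
      ∀ t : K, ‖t‖ < δ → c * ‖t‖ ^ m ≤ ‖Polynomial.aeval t R‖ := by
  obtain ⟨S, hS, hdvd⟩ := Polynomial.exists_eq_pow_rootMultiplicity_mul_and_not_dvd R hR 0
  generalize R.rootMultiplicity 0 = m at hS
  have h0 : Polynomial.aeval (0 : K) S ≠ 0 := by
    rw [Polynomial.dvd_iff_isRoot, Polynomial.IsRoot, ← Polynomial.coeff_zero_eq_eval_zero] at hdvd
    rw [Polynomial.aeval_def, Polynomial.eval₂_at_zero]
    exact (map_ne_zero (algebraMap ℚ K)).mpr hdvd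
  have hpos : 0 < ‖Polynomial.aeval (0 : K) S‖ := norm_pos_iff.mpr h0
  have hcont : Continuous fun t : K => ‖Polynomial.aeval t S‖ := S.continuous_aeval.norm
  obtain ⟨δ, hδ, h⟩ := Metric.eventually_nhds_iff.mp
    (hcont.continuousAt.eventually (lt_mem_nhds (half_lt_self hpos)))
  refine ⟨‖Polynomial.aeval (0 : K) S‖ / 2, m, δ, by positivity, hδ, fun t ht => ?_⟩
  have := (h (y := t) (by simpa using ht)).le
  rw [hS, map_mul, norm_mul, map_pow, norm_pow, map_sub, Polynomial.aeval_X, Polynomial.aeval_C,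
    map_zero, sub_zero, mul_comm]
  gcongr

section LowerBound

variable {K : Type*} [NormedField K] [IsUltrametricDist K] [Algebra ℚ K]

theorem exists_norm_eval₂_form_le {d : ℕ} {P : MvPolynomial (Fin 2) (Polynomial ℚ)}
    (hP : P.IsHomogeneous d) : ∃ C : ℝ, 0 ≤ C ∧ ∀ (t : K) (x : Fin 2 → K), ‖t‖ ≤ 1 →
      ‖MvPolynomial.eval₂ (Polynomial.aeval t).toRingHom x P‖ ≤ C * ‖x‖ ^ d := by
  obtain ⟨C, hC, h⟩ := Approx.eval₂_form (K := K) hP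
  refine ⟨C, hC, fun t x ht => (h 1 ‖x‖ t x 0 le_rfl ht fun i => ?_).1⟩
  simpa [Approx] using norm_le_pi_norm x i

theorem exists_norm_apply_one_pow_le {d : ℕ} (hd : 1 ≤ d)
    {P Q : MvPolynomial (Fin 2) (Polynomial ℚ)}
    (hP : P.IsHomogeneous d) (hQ : Q.IsHomogeneous d) (tstar : ℂ)
    (hgood : ∀ x : Fin 2 → ℂ, x ≠ 0 →
        ¬(MvPolynomial.eval₂ (Polynomial.aeval tstar).toRingHom x P = 0 ∧
          MvPolynomial.eval₂ (Polynomial.aeval tstar).toRingHom x Q = 0)) :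
    ∃ (R : Polynomial ℚ) (D : ℝ), R ≠ 0 ∧ 0 ≤ D ∧
      ∀ (t : K) (x : Fin 2 → K) (N : ℝ), ‖t‖ ≤ 1 →
        ‖MvPolynomial.eval₂ (Polynomial.aeval t).toRingHom x P‖ ≤ N →
        ‖MvPolynomial.eval₂ (Polynomial.aeval t).toRingHom x Q‖ ≤ N →
        ‖Polynomial.aeval t R‖ * ‖x 1‖ ^ (d + (d - 1)) ≤ D * ‖x‖ ^ (d - 1) * N := by
  obtain ⟨R, a, b, hR, ha, hb, hab⟩ := exists_bezout_form hd hP hQ tstar hgood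
  obtain ⟨C, hC, hCa⟩ := exists_norm_eval₂_form_le (K := K) ha
  obtain ⟨D, hD, hDb⟩ := exists_norm_eval₂_form_le (K := K) hb
  refine ⟨R, C + D, hR, by positivity, fun t x N ht hPN hQN => ?_⟩
  have hN : 0 ≤ N := (norm_nonneg _).trans hPN
  have key := congrArg (MvPolynomial.eval₂ (Polynomial.aeval t).toRingHom x) hab
  simp only [MvPolynomial.eval₂_add, MvPolynomial.eval₂_mul, MvPolynomial.eval₂_C,
    MvPolynomial.eval₂_pow, MvPolynomial.eval₂_X] at key
  have hR' : (Polynomial.aeval t).toRingHom R = Polynomial.aeval t R := rfl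
  rw [← norm_pow, ← norm_mul, ← hR', ← key]
  refine (norm_add_le _ _).trans ?_
  rw [norm_mul, norm_mul]
  calc _ ≤ N * (C * ‖x‖ ^ (d - 1)) + N * (D * ‖x‖ ^ (d - 1)) := by
        have := hCa t x ht
        have := hDb t x ht
        gcongr
    _ = _ := by ring

end LowerBound

section Specialization

variable {p : ℕ} [Fact p.Prime] {d : ℕ} {P Q : MvPolynomial (Fin 2) (Polynomial ℚ)}

theorem exists_lower_bound_specQp (hd : 1 ≤ d)
    (hP : P.IsHomogeneous d) (hQ : Q.IsHomogeneous d) (tstar : ℂ)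
    (hgood : ∀ x : Fin 2 → ℂ, x ≠ 0 →
        ¬(MvPolynomial.eval₂ (Polynomial.aeval tstar).toRingHom x P = 0 ∧
          MvPolynomial.eval₂ (Polynomial.aeval tstar).toRingHom x Q = 0)) :
    ∃ (c : ℝ) (m : ℕ) (δ : ℝ), 0 < c ∧ 0 < δ ∧ ∀ (t : ℚ_[p]) (x : Fin 2 → ℚ_[p]), ‖t‖ < δ →
      c * ‖t‖ ^ m * ‖x‖ ^ d ≤ ‖specQp p P Q t x‖ := by
  obtain ⟨R₁, D₁, hR₁, hD₁, h₁⟩ := exists_norm_apply_one_pow_le (K := ℚ_[p]) hd hP hQ tstar hgood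
  obtain ⟨R₀, D₀, hR₀, hD₀, h₀⟩ := exists_norm_apply_one_pow_le (K := ℚ_[p]) hd
    (hP.rename_isHomogeneous (f := Equiv.swap 0 1)) (hQ.rename_isHomogeneous (f := Equiv.swap 0 1))
    tstar (fun x hx => by
      rw [MvPolynomial.eval₂_rename, MvPolynomial.eval₂_rename]
      refine hgood _ fun h => hx (funext fun i => ?_)
      simpa using congrFun h (Equiv.swap 0 1 i))
  obtain ⟨c₁, m₁, δ₁, hc₁, hδ₁, hl₁⟩ := exists_lower_bound_aeval (K := ℚ_[p]) hR₁
  obtain ⟨c₀, m₀, δ₀, hc₀, hδ₀, hl₀⟩ := exists_lower_bound_aeval (K := ℚ_[p]) hR₀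
  have hD : 0 < D₀ + D₁ + 1 := by positivity
  refine ⟨min c₀ c₁ / (D₀ + D₁ + 1), m₀ + m₁, min 1 (min δ₀ δ₁), by positivity, by positivity,
    fun t x ht => ?_⟩
  simp only [lt_min_iff] at ht
  obtain ⟨ht, ht₀, ht₁⟩ := ht
  rcases eq_or_ne x 0 with rfl | hx
  · simp [show d ≠ 0 by omega]
  have hx' : 0 < ‖x‖ := norm_pos_iff.mpr hx
  have hN0 : ‖MvPolynomial.eval₂ (Polynomial.aeval t).toRingHom x P‖ ≤ ‖specQp p P Q t x‖ :=
    norm_le_pi_norm (specQp p P Q t x) 0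
  have hN1 : ‖MvPolynomial.eval₂ (Polynomial.aeval t).toRingHom x Q‖ ≤ ‖specQp p P Q t x‖ :=
    norm_le_pi_norm (specQp p P Q t x) 1
  set N := ‖specQp p P Q t x‖
  have hcomp : (x ∘ Equiv.swap (0 : Fin 2) 1) ∘ Equiv.swap (0 : Fin 2) 1 = x := by
    ext i; simp
  have hnorm : ‖x ∘ Equiv.swap (0 : Fin 2) 1‖ ≤ ‖x‖ :=
    (pi_norm_le_iff_of_nonneg hx'.le).mpr fun i => norm_le_pi_norm x _
  have k₁ := h₁ t x N ht.le hN0 hN1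
  have k₀ := h₀ t (x ∘ Equiv.swap (0 : Fin 2) 1) N ht.le
    (by rwa [MvPolynomial.eval₂_rename, hcomp]) (by rwa [MvPolynomial.eval₂_rename, hcomp])
  simp only [Function.comp_apply, Equiv.swap_apply_right] at k₀
  have hN : 0 ≤ N := norm_nonneg _
  have main : min c₀ c₁ * ‖t‖ ^ (m₀ + m₁) * ‖x‖ ^ (d + (d - 1)) ≤
      (D₀ + D₁ + 1) * ‖x‖ ^ (d - 1) * N := by
    rcases max_choice ‖x 0‖ ‖x 1‖ with hi | hi <;> rw [← norm_fin_two] at hi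
    · calc min c₀ c₁ * ‖t‖ ^ (m₀ + m₁) * ‖x‖ ^ (d + (d - 1))
          ≤ ‖Polynomial.aeval t R₀‖ * ‖x‖ ^ (d + (d - 1)) := by
            gcongr
            refine le_trans ?_ (hl₀ t ht₀)
            exact mul_le_mul (min_le_left _ _)
              (pow_le_pow_of_le_one (norm_nonneg _) ht.le (by omega)) (by positivity) hc₀.le
        _ ≤ D₀ * ‖x ∘ Equiv.swap (0 : Fin 2) 1‖ ^ (d - 1) * N := by rw [hi]; exact k₀
        _ ≤ _ := by
            gcongr
            linarith
    · calc min c₀ c₁ * ‖t‖ ^ (m₀ + m₁) * ‖x‖ ^ (d + (d - 1))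
          ≤ ‖Polynomial.aeval t R₁‖ * ‖x‖ ^ (d + (d - 1)) := by
            gcongr
            refine le_trans ?_ (hl₁ t ht₁)
            exact mul_le_mul (min_le_right _ _)
              (pow_le_pow_of_le_one (norm_nonneg _) ht.le (by omega)) (by positivity) hc₁.le
        _ ≤ D₁ * ‖x‖ ^ (d - 1) * N := by nth_rewrite 1 [hi]; exact k₁
        _ ≤ _ := by
            gcongr
            linarith
  rw [div_mul_eq_mul_div, div_mul_eq_mul_div, div_le_iff₀ hD]
  refine le_of_mul_le_mul_right ?_ (pow_pos hx' (d - 1))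
  calc _ = min c₀ c₁ * ‖t‖ ^ (m₀ + m₁) * ‖x‖ ^ (d + (d - 1)) := by rw [pow_add]; ring
    _ ≤ _ := main
    _ = _ := by ring

theorem inv_abs_le_norm_intCast {k : ℤ} (hk : k ≠ 0) : |(k : ℝ)|⁻¹ ≤ ‖(k : ℚ_[p])‖ := by
  have h : ‖(k : ℚ_[p])‖ = ((p ^ padicValInt p k : ℕ) : ℝ)⁻¹ := by
    rw [← Rat.cast_intCast, Padic.eq_padicNorm,
      padicNorm.eq_zpow_of_nonzero (by exact_mod_cast hk)]
    simp
  have hle : p ^ padicValInt p k ≤ k.natAbs :=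
    Nat.le_of_dvd (Int.natAbs_pos.mpr hk) pow_padicValNat_dvd
  rw [h, ← Int.cast_abs, Int.abs_eq_natAbs, Int.cast_natCast]
  have hpos : 0 < p ^ padicValInt p k := pow_pos (Fact.out : p.Prime).pos _
  gcongr

theorem specQp_smul (hP : P.IsHomogeneous d) (hQ : Q.IsHomogeneous d) (t c : ℚ_[p])
    (x : Fin 2 → ℚ_[p]) : specQp p P Q t (c • x) = c ^ d • specQp p P Q t x := by
  ext i
  fin_cases i
  · exact hP.eval₂_smul _ c x
  · exact hQ.eval₂_smul _ c x

theorem exists_int_common_factor (hd : 1 ≤ d)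
    (hP : P.IsHomogeneous d) (hQ : Q.IsHomogeneous d)
    (hcoeff : ¬((MvPolynomial.map (Polynomial.evalRingHom (0 : ℚ)) P = 0) ∧
               (MvPolynomial.map (Polynomial.evalRingHom (0 : ℚ)) Q = 0)))
    (hbad : ∃ x : Fin 2 → ℂ, x ≠ 0 ∧
        MvPolynomial.eval₂ (Polynomial.aeval (0 : ℂ)).toRingHom x P = 0 ∧
        MvPolynomial.eval₂ (Polynomial.aeval (0 : ℂ)).toRingHom x Q = 0) :
    ∃ (N : ℤ) (e : ℕ) (G U V : MvPolynomial (Fin 2) ℤ), N ≠ 0 ∧ e < d ∧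
      U.IsHomogeneous e ∧ V.IsHomogeneous e ∧ (G * U).IsHomogeneous d ∧ (G * V).IsHomogeneous d ∧
      MvPolynomial.map (Int.castRingHom ℚ) (G * U) =
        MvPolynomial.C (N : ℚ) * MvPolynomial.map (Polynomial.evalRingHom (0 : ℚ)) P ∧
      MvPolynomial.map (Int.castRingHom ℚ) (G * V) =
        MvPolynomial.C (N : ℚ) * MvPolynomial.map (Polynomial.evalRingHom (0 : ℚ)) Q := by
  obtain ⟨x, hx, hPx, hQx⟩ := hbad
  have hcomp : (Polynomial.aeval (0 : ℂ)).toRingHom =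
      (algebraMap ℚ ℂ).comp (Polynomial.evalRingHom (0 : ℚ)) := by
    ext <;> simp
  have hspec : ∀ S : MvPolynomial (Fin 2) (Polynomial ℚ),
      MvPolynomial.eval₂ (Polynomial.aeval (0 : ℂ)).toRingHom x S =
        MvPolynomial.aeval x (MvPolynomial.map (Polynomial.evalRingHom (0 : ℚ)) S) := by
    intro S
    rw [MvPolynomial.aeval_def, MvPolynomial.eval₂_map, hcomp]
  rw [hspec] at hPx hQx
  obtain ⟨e, G, U, V, he, hG, hU, hV, hGU, hGV⟩ :=
    exists_common_factor hd (hP.map _) (hQ.map _) hcoeff x hx hPx hQx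
  have hinj : Function.Injective (Int.castRingHom ℚ) := Int.cast_injective
  obtain ⟨k, G', hk, hG'⟩ := MvPolynomial.exists_int_multiple G
  obtain ⟨l, U', hl, hU'⟩ := MvPolynomial.exists_int_multiple U
  obtain ⟨m, V', hm, hV'⟩ := MvPolynomial.exists_int_multiple V
  have hU'' : MvPolynomial.map (Int.castRingHom ℚ) (MvPolynomial.C m * U') =
      MvPolynomial.C ((l * m : ℤ) : ℚ) * U := by
    rw [map_mul, MvPolynomial.map_C, hU', eq_intCast, Int.cast_mul, map_mul]; ring
  have hV'' : MvPolynomial.map (Int.castRingHom ℚ) (MvPolynomial.C l * V') =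
      MvPolynomial.C ((l * m : ℤ) : ℚ) * V := by
    rw [map_mul, MvPolynomial.map_C, hV', eq_intCast, Int.cast_mul, map_mul]; ring
  have hUe := MvPolynomial.IsHomogeneous.of_map (n := e) hinj (by rw [hU'']; exact hU.C_mul _)
  have hVe := MvPolynomial.IsHomogeneous.of_map (n := e) hinj (by rw [hV'']; exact hV.C_mul _)
  have hGe := MvPolynomial.IsHomogeneous.of_map (n := d - e) hinj (by rw [hG']; exact hG.C_mul _)
  refine ⟨k * (l * m), e, G', MvPolynomial.C m * U', MvPolynomial.C l * V',
    mul_ne_zero hk (mul_ne_zero hl hm), he, hUe, hVe, ?_, ?_, ?_, ?_⟩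
  · simpa [Nat.sub_add_cancel he.le] using hGe.mul hUe
  · simpa [Nat.sub_add_cancel he.le] using hGe.mul hVe
  · rw [map_mul, hU'', hG', hGU, Int.cast_mul k, map_mul MvPolynomial.C (k : ℚ)]; ring
  · rw [map_mul, hV'', hG', hGV, Int.cast_mul k, map_mul MvPolynomial.C (k : ℚ)]; ring

theorem exists_log_growth_bound {E : ℕ} (hE : 1 ≤ E) {e : ℕ} (he : e ≤ E)
    {U V : MvPolynomial (Fin 2) ℤ} (hU : U.IsHomogeneous e) (hV : V.IsHomogeneous e)
    (b : ℕ → Fin 2 → ℤ)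
    (hb : ∀ n, b (n + 1) = ![MvPolynomial.eval (b n) U, MvPolynomial.eval (b n) V]) :
    ∃ D : ℝ, 0 ≤ D ∧ ∀ n i, |(b n i : ℝ)| ≤ Real.exp (D * ((n + 1) * E ^ n)) := by
  obtain ⟨C₁, hC₁, h₁⟩ := norm_int_form_le hU
  obtain ⟨C₂, hC₂, h₂⟩ := norm_int_form_le hV
  set C := C₁ + C₂ + |(b 0 0 : ℝ)| + |(b 0 1 : ℝ)| with hC
  have hCC : C ≤ Real.exp C := by linarith [Real.add_one_le_exp C]
  have hC0 : 0 ≤ C := by positivity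
  have a0 := abs_nonneg (b 0 0 : ℝ)
  have a1 := abs_nonneg (b 0 1 : ℝ)
  refine ⟨C, hC0, fun n => ?_⟩
  induction n with
  | zero =>
    intro i
    simp only [Nat.cast_zero, zero_add, pow_zero, mul_one]
    refine le_trans ?_ hCC
    fin_cases i
    · simp only [Fin.zero_eta]; linarith
    · simp only [Fin.mk_one]; linarith
  | succ n ih =>
    have key : C * Real.exp (C * ((n + 1) * E ^ n)) ^ e ≤
        Real.exp (C * (((n + 1 : ℕ) + 1) * E ^ (n + 1))) := by
      have hE' : (1 : ℝ) ≤ E := by exact_mod_cast hE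
      have hE1 : (1 : ℝ) ≤ (E : ℝ) ^ (n + 1) := one_le_pow₀ hE'
      calc C * Real.exp (C * ((n + 1) * E ^ n)) ^ e
          ≤ Real.exp C * Real.exp (C * ((n + 1) * E ^ n)) ^ E := by
            gcongr
            exact Real.one_le_exp (by positivity)
        _ = Real.exp (C + C * ((n + 1) * E ^ (n + 1))) := by
            rw [← Real.exp_nat_mul, ← Real.exp_add]; ring_nf
        _ ≤ _ := by
            apply Real.exp_le_exp.mpr
            push_cast
            nlinarith [mul_le_mul_of_nonneg_left hE1 hC0]
    intro i
    rw [hb]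
    fin_cases i
    · refine (h₁ (b n) _ ih).trans (le_trans ?_ key)
      gcongr
      linarith
    · refine (h₂ (b n) _ ih).trans (le_trans ?_ key)
      gcongr
      linarith

theorem intCast_mul_eval₂_zero {N : ℤ} {S : MvPolynomial (Fin 2) ℤ}
    (hS : MvPolynomial.map (Int.castRingHom ℚ) S =
        MvPolynomial.C (N : ℚ) * MvPolynomial.map (Polynomial.evalRingHom (0 : ℚ)) P)
    (b : Fin 2 → ℤ) :
    (N : ℚ_[p]) * MvPolynomial.eval₂ (Polynomial.aeval (0 : ℚ_[p])).toRingHom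
      (fun i => (b i : ℚ_[p])) P = ((MvPolynomial.eval b S : ℤ) : ℚ_[p]) := by
  have hcomp : (Polynomial.aeval (0 : ℚ_[p])).toRingHom =
      (algebraMap ℚ ℚ_[p]).comp (Polynomial.evalRingHom (0 : ℚ)) := by
    ext <;> simp
  have h := congrArg (MvPolynomial.eval₂ (algebraMap ℚ ℚ_[p]) fun i => (b i : ℚ_[p])) hS
  rw [MvPolynomial.eval₂_mul, MvPolynomial.eval₂_C, MvPolynomial.eval₂_map, MvPolynomial.eval₂_map,
    ← hcomp, map_intCast] at h
  rw [← h, MvPolynomial.eval₂_eq', MvPolynomial.eval_eq']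
  simp

theorem exists_smul_intCast_eq (x : Fin 2 → ℚ) :
    ∃ (c : ℚ_[p]) (b : Fin 2 → ℤ), (fun i => (x i : ℚ_[p])) = c • fun i => (b i : ℚ_[p]) := by
  refine ⟨((x 0).den * (x 1).den : ℚ_[p])⁻¹, ![(x 0).num * (x 1).den, (x 1).num * (x 0).den], ?_⟩
  have h0 : ((x 0).den : ℚ_[p]) ≠ 0 := by simp
  have h1 : ((x 1).den : ℚ_[p]) ≠ 0 := by simp
  ext i
  fin_cases i
  · simp [Rat.cast_def (x 0)]
    field_simp
  · simp [Rat.cast_def (x 1)]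
    field_simp

theorem exists_orbit_lower_bound (hd : 2 ≤ d) (hP : P.IsHomogeneous d) (hQ : Q.IsHomogeneous d)
    (hcoeff : ¬((MvPolynomial.map (Polynomial.evalRingHom (0 : ℚ)) P = 0) ∧
               (MvPolynomial.map (Polynomial.evalRingHom (0 : ℚ)) Q = 0)))
    (hbad : ∃ x : Fin 2 → ℂ, x ≠ 0 ∧
        MvPolynomial.eval₂ (Polynomial.aeval (0 : ℂ)).toRingHom x P = 0 ∧
        MvPolynomial.eval₂ (Polynomial.aeval (0 : ℂ)).toRingHom x Q = 0)
    (x : Fin 2 → ℚ) (y : ℕ → Fin 2 → ℚ_[p]) (hy0 : y 0 = fun i => (x i : ℚ_[p]))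
    (hy : ∀ n, y (n + 1) = specQp p P Q 0 (y n)) (hne : ∀ n, y n ≠ 0) :
    ∃ D : ℝ, 0 ≤ D ∧ ∀ n : ℕ, Real.exp (-(D * ((n + 1) * ((d - 1 : ℕ) : ℝ) ^ n))) * ‖y n‖ ^ d ≤
      ‖y (n + 1)‖ := by
  obtain ⟨N, e, G, U, V, hN, he, hU, hV, hGU, hGV, hPN, hQN⟩ :=
    exists_int_common_factor (by omega) hP hQ hcoeff hbad
  obtain ⟨c, b₀, hb₀⟩ := exists_smul_intCast_eq (p := p) x
  let b : ℕ → Fin 2 → ℤ := fun n =>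
    (fun v => ![MvPolynomial.eval v U, MvPolynomial.eval v V])^[n] b₀
  have hb : ∀ n, b (n + 1) = ![MvPolynomial.eval (b n) U, MvPolynomial.eval (b n) V] :=
    fun n => Function.iterate_succ_apply' _ _ _
  have hN' : (N : ℚ_[p]) ≠ 0 := by exact_mod_cast hN
  have hspec : ∀ v : Fin 2 → ℤ, (N : ℚ_[p]) • specQp p P Q 0 (fun i => (v i : ℚ_[p])) =
      ![((MvPolynomial.eval v (G * U) : ℤ) : ℚ_[p]),
        ((MvPolynomial.eval v (G * V) : ℤ) : ℚ_[p])] := by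
    intro v
    rw [← intCast_mul_eval₂_zero hPN v, ← intCast_mul_eval₂_zero hQN v]
    ext i
    fin_cases i <;> rfl
  have hprop : ∀ n, ∃ l : ℚ_[p], y n = l • fun i => (b n i : ℚ_[p]) := by
    intro n
    induction n with
    | zero => exact ⟨c, by rw [hy0, hb₀]; rfl⟩
    | succ n ih =>
      obtain ⟨l, hl⟩ := ih
      refine ⟨l ^ d * (N : ℚ_[p])⁻¹ * ((MvPolynomial.eval (b n) G : ℤ) : ℚ_[p]), ?_⟩
      rw [hy, hl, specQp_smul hP hQ, hb, mul_assoc, mul_smul]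
      congr 1
      rw [eq_comm, mul_smul, inv_smul_eq_iff₀ hN', hspec]
      ext i
      fin_cases i <;> simp
  obtain ⟨D, hD, hDb⟩ := exists_log_growth_bound (E := d - 1) (by omega) (by omega) hU hV b hb
  obtain ⟨C₁, hC₁, h₁⟩ := norm_int_form_le hGU
  obtain ⟨C₂, hC₂, h₂⟩ := norm_int_form_le hGV
  refine ⟨C₁ + C₂ + d * D, by positivity, fun n => ?_⟩
  obtain ⟨l, hl⟩ := hprop n
  set v : Fin 2 → ℚ_[p] := fun i => (b n i : ℚ_[p]) with hv
  have hv1 : ‖v‖ ≤ 1 :=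
    (pi_norm_le_iff_of_nonneg zero_le_one).mpr fun i => Padic.norm_int_le_one _
  have hFne : (N : ℚ_[p]) • specQp p P Q 0 v ≠ 0 := by
    intro h
    apply hne (n + 1)
    rw [hy, hl, specQp_smul hP hQ, (smul_eq_zero_iff_right hN').mp h, smul_zero]
  set T : ℝ := (n + 1) * ((d - 1 : ℕ) : ℝ) ^ n with hT
  have hT1 : 1 ≤ T := by
    have : (1 : ℝ) ≤ ((d - 1 : ℕ) : ℝ) ^ n :=
      one_le_pow₀ (by exact_mod_cast (by omega : 1 ≤ d - 1))
    have hn : (1 : ℝ) ≤ n + 1 := by linarith [Nat.cast_nonneg (α := ℝ) n]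
    exact one_le_mul_of_one_le_of_one_le hn this
  have hsize : ∀ k : ℤ, k ≠ 0 → |(k : ℝ)| ≤ (C₁ + C₂) * Real.exp (D * T) ^ d →
      Real.exp (-((C₁ + C₂ + d * D) * T)) ≤ ‖(k : ℚ_[p])‖ := by
    intro k hk hkle
    refine le_trans ?_ (inv_abs_le_norm_intCast hk)
    rw [Real.exp_neg]
    have hk0 : 0 < |(k : ℝ)| := by positivity
    refine inv_anti₀ hk0 (hkle.trans ?_)
    calc (C₁ + C₂) * Real.exp (D * T) ^ d ≤ Real.exp ((C₁ + C₂) * T) * Real.exp (D * T) ^ d := by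
          gcongr
          have := Real.add_one_le_exp ((C₁ + C₂) * T)
          nlinarith [mul_le_mul_of_nonneg_left hT1 (add_nonneg hC₁ hC₂)]
      _ = _ := by
          rw [← Real.exp_nat_mul, ← Real.exp_add]; ring_nf
  have hmain : Real.exp (-((C₁ + C₂ + d * D) * T)) ≤ ‖specQp p P Q 0 v‖ := by
    have hle : ‖(N : ℚ_[p]) • specQp p P Q 0 v‖ ≤ ‖specQp p P Q 0 v‖ := by
      rw [norm_smul]
      exact mul_le_of_le_one_left (norm_nonneg _) (Padic.norm_int_le_one _)
    refine le_trans ?_ hle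
    rw [hspec] at hFne ⊢
    have hB := Real.exp_pos (D * T)
    by_cases hk : MvPolynomial.eval (b n) (G * U) = 0
    · have hk' : MvPolynomial.eval (b n) (G * V) ≠ 0 := by
        intro h
        apply hFne
        ext i
        fin_cases i <;> simp only [hk, h] <;> simp
      rw [norm_fin_two]
      refine le_trans (hsize _ hk' ((h₂ _ _ (hDb n)).trans ?_)) (le_max_right _ _)
      gcongr
      linarith
    · rw [norm_fin_two]
      refine le_trans (hsize _ hk ((h₁ _ _ (hDb n)).trans ?_)) (le_max_left _ _)
      gcongr
      linarith
  rw [hy, hl, specQp_smul hP hQ, norm_smul, norm_smul, norm_pow, mul_pow]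
  calc _ ≤ Real.exp (-((C₁ + C₂ + d * D) * T)) * (‖l‖ ^ d * 1) := by
        gcongr
        exact pow_le_one₀ (norm_nonneg _) hv1
    _ = ‖l‖ ^ d * Real.exp (-((C₁ + C₂ + d * D) * T)) := by ring
    _ ≤ _ := by gcongr

theorem exists_specQp_sub_le (hP : P.IsHomogeneous d) (hQ : Q.IsHomogeneous d) :
    ∃ C : ℝ, 0 ≤ C ∧
      (∀ (r M : ℝ) (t : ℚ_[p]) (u v : Fin 2 → ℚ_[p]), r ≤ 1 → ‖t‖ ≤ r → ‖u‖ ≤ M → ‖v‖ ≤ M →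
        ‖u - v‖ ≤ r * M → ‖specQp p P Q t u - specQp p P Q 0 v‖ ≤ Real.exp C * r * M ^ d) ∧
      ∀ (t : ℚ_[p]) (u : Fin 2 → ℚ_[p]), ‖t‖ ≤ 1 →
        ‖specQp p P Q t u‖ ≤ Real.exp C * ‖u‖ ^ d := by
  obtain ⟨C₁, hC₁, h₁⟩ := Approx.eval₂_form (K := ℚ_[p]) hP
  obtain ⟨C₂, hC₂, h₂⟩ := Approx.eval₂_form (K := ℚ_[p]) hQ
  have hexp := Real.add_one_le_exp (C₁ + C₂)
  have hexp₁ : C₁ ≤ Real.exp (C₁ + C₂) := by linarith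
  have hexp₂ : C₂ ≤ Real.exp (C₁ + C₂) := by linarith
  refine ⟨C₁ + C₂, by positivity, fun r M t u v hr ht hu hv huv => ?_, fun t u ht => ?_⟩
  · have happ : ∀ i, Approx r M (u i) (v i) := fun i =>
      ⟨(norm_le_pi_norm u i).trans hu, (norm_le_pi_norm v i).trans hv,
        (norm_le_pi_norm (u - v) i).trans huv⟩
    have hr0 : 0 ≤ r := (norm_nonneg _).trans ht
    have hM0 : 0 ≤ M := (norm_nonneg _).trans hu
    rw [norm_fin_two]
    refine max_le ((h₁ r M t u v hr ht happ).2.2.trans ?_)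
      ((h₂ r M t u v hr ht happ).2.2.trans ?_) <;>
    · rw [← mul_assoc, mul_comm r]
      gcongr
  · have happ : ∀ i, Approx 1 ‖u‖ (u i) (u i) := fun i =>
      ⟨norm_le_pi_norm u i, norm_le_pi_norm u i, by simp⟩
    rw [norm_fin_two]
    refine max_le ((h₁ 1 _ t u u le_rfl ht happ).1.trans ?_)
      ((h₂ 1 _ t u u le_rfl ht happ).1.trans ?_) <;>
    gcongr

theorem exists_aeval_sub_le {K : Type*} [NormedField K] [IsUltrametricDist K] [Algebra ℚ K]
    (A : Fin 2 → Polynomial ℚ) :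
    ∃ C : ℝ, 0 ≤ C ∧ ∀ t : K, ‖t‖ ≤ 1 →
      ‖(fun i => Polynomial.aeval t (A i)) - fun i => Polynomial.aeval (0 : K) (A i)‖ ≤
        C * ‖t‖ := by
  choose C hC h using fun i => Approx.aeval (K := K) (A i)
  refine ⟨C 0 + C 1, add_nonneg (hC 0) (hC 1), fun t ht => ?_⟩
  have hC0 := hC 0
  have hC1 := hC 1
  rw [norm_fin_two]
  refine max_le ((h 0 ‖t‖ t ht le_rfl).2.2.trans ?_) ((h 1 ‖t‖ t ht le_rfl).2.2.trans ?_) <;>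
  · rw [mul_comm]
    gcongr
    linarith

theorem aeval_polyMapQp (x : Fin 2 → Polynomial ℚ) (t : ℚ_[p]) :
    (fun i => Polynomial.aeval t (polyMapQp P Q x i)) =
      specQp p P Q t fun i => Polynomial.aeval t (x i) := by
  ext i
  fin_cases i <;> simp [polyMapQp, specQp, MvPolynomial.eval_eq', MvPolynomial.eval₂_eq']

theorem aeval_iterate_polyMapQp (A : Fin 2 → Polynomial ℚ) (t : ℚ_[p]) (n : ℕ) :
    (fun i => Polynomial.aeval t (((polyMapQp P Q)^[n] A) i)) =
      (specQp p P Q t)^[n] fun i => Polynomial.aeval t (A i) := by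
  induction n with
  | zero => rfl
  | succ n ih =>
    rw [Function.iterate_succ_apply', Function.iterate_succ_apply', aeval_polyMapQp, ih]

end Specialization

/-- uniform convergence of the escape-rate functions
`g_n(t) = d^{-n} log ‖(Fⁿ(A))(t)‖_p` on a `p`-adic disk around a singular parameter
`t = 0`, for a hole-avoiding pair `(F, A)`. -/
theorem stmt_6 (p : ℕ) [Fact p.Prime] (d : ℕ) (hd : 2 ≤ d)
    (P Q : MvPolynomial (Fin 2) (Polynomial ℚ))
    (hP : P.IsHomogeneous d) (hQ : Q.IsHomogeneous d)
    (A : Fin 2 → Polynomial ℚ)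
    -- (i): not all coefficients of P and Q vanish at t = 0
    (hcoeff : ¬((MvPolynomial.map (Polynomial.evalRingHom (0 : ℚ)) P = 0) ∧
               (MvPolynomial.map (Polynomial.evalRingHom (0 : ℚ)) Q = 0)))
    -- (ii): P₀, Q₀ have a common zero in ℂ² ∖ {0}, but some specialization P_{t*}, Q_{t*} has none
    (hbad : ∃ x : Fin 2 → ℂ, x ≠ 0 ∧
        MvPolynomial.eval₂ (Polynomial.aeval (0 : ℂ)).toRingHom x P = 0 ∧
        MvPolynomial.eval₂ (Polynomial.aeval (0 : ℂ)).toRingHom x Q = 0)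
    (hgood : ∃ tstar : ℂ, ∀ x : Fin 2 → ℂ, x ≠ 0 →
        ¬(MvPolynomial.eval₂ (Polynomial.aeval tstar).toRingHom x P = 0 ∧
          MvPolynomial.eval₂ (Polynomial.aeval tstar).toRingHom x Q = 0))
    -- (iii): the pair (F, A) is hole-avoiding at t = 0
    (hhole : ∀ n : ℕ, (specQp p P Q 0)^[n] (fun i => Polynomial.aeval (0 : ℚ_[p]) (A i)) ≠ 0) :
    ∃ δ : ℝ, 0 < δ ∧ ∃ g : ℚ_[p] → ℝ,
      ContinuousOn g (Metric.ball (0 : ℚ_[p]) δ) ∧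
      (∀ n : ℕ, ∀ t ∈ Metric.ball (0 : ℚ_[p]) δ,
        (fun i => Polynomial.aeval t (((polyMapQp P Q)^[n] A) i)) ≠ (0 : Fin 2 → ℚ_[p])) ∧
      TendstoUniformlyOn
        (fun n : ℕ => fun t : ℚ_[p] => ((d : ℝ) ^ n)⁻¹ *
          Real.log (max ‖Polynomial.aeval t (((polyMapQp P Q)^[n] A) 0)‖
                        ‖Polynomial.aeval t (((polyMapQp P Q)^[n] A) 1)‖))
        g atTop (Metric.ball (0 : ℚ_[p]) δ) := by
  obtain ⟨tstar, hgood⟩ := hgood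
  obtain ⟨C, hC, hF, hFle⟩ := exists_specQp_sub_le (p := p) hP hQ
  obtain ⟨B, hB, hA⟩ := exists_aeval_sub_le (K := ℚ_[p]) A
  obtain ⟨c, m, δ, hc, hδ, hlower⟩ :=
    exists_lower_bound_specQp (p := p) (by omega : 1 ≤ d) hP hQ tstar hgood
  let x : ℕ → ℚ_[p] → Fin 2 → ℚ_[p] := fun n t i => Polynomial.aeval t (((polyMapQp P Q)^[n] A) i)
  have hx : ∀ n t, x (n + 1) t = specQp p P Q t (x n t) := fun n t => by
    simp only [x, Function.iterate_succ_apply']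
    exact aeval_polyMapQp _ t
  have hne : ∀ n, x n 0 ≠ 0 := fun n => by
    simpa only [x, aeval_iterate_polyMapQp] using hhole n
  obtain ⟨D, hD, hlow⟩ := exists_orbit_lower_bound hd hP hQ hcoeff hbad
    (fun i => (A i).eval 0) (fun n => x n 0)
    (by
      ext i
      simp [x, Polynomial.aeval_def, Polynomial.eval₂_at_zero, Polynomial.coeff_zero_eq_eval_zero])
    (fun n => hx n 0) hne
  have hx0 : 0 < ‖x 0 0‖ := norm_pos_iff.mpr (hne 0)
  have hB1 : 0 < B + 1 := by positivity
  set ρ : ℝ := min 1 (min δ (‖x 0 0‖ / (B + 1))) with hρdef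
  have hρ : 0 < ρ := by positivity
  have hρ1 : ρ ≤ 1 := min_le_left _ _
  have hρδ : ρ ≤ δ := (min_le_right _ _).trans (min_le_left _ _)
  have hρB : ρ * (B + 1) ≤ ‖x 0 0‖ :=
    (le_div_iff₀ hB1).mp ((min_le_right _ _).trans (min_le_right _ _))
  have h0 : ∀ t, ‖t‖ < ρ → ‖x 0 t - x 0 0‖ ≤ ‖t‖ / ρ * ‖x 0 0‖ := fun t ht =>
    calc ‖x 0 t - x 0 0‖ ≤ B * ‖t‖ := hA t (ht.le.trans hρ1)
      _ ≤ (B + 1) * ‖t‖ := by gcongr; linarith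
      _ = ‖t‖ / ρ * (ρ * (B + 1)) := by field_simp
      _ ≤ ‖t‖ / ρ * ‖x 0 0‖ := by gcongr
  obtain ⟨hnz, u, hu, hinc⟩ := exists_summable_increment_bound hd hx hF hFle hne hC hD hlow hρ hρ1
    h0 hc fun t v ht => hlower t v (ht.trans_le hρδ)
  have hcont : ∀ n, ContinuousOn (fun t => ((d : ℝ) ^ n)⁻¹ * Real.log ‖x n t‖)
      (Metric.ball (0 : ℚ_[p]) ρ) := fun n => by
    have hxc : Continuous (x n) := continuous_pi fun i => Polynomial.continuous_aeval _
    exact continuousOn_const.mul (hxc.norm.continuousOn.log fun t ht =>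
      norm_ne_zero_iff.mpr (hnz n t (mem_ball_zero_iff.mp ht)))
  obtain ⟨g, hg, hlim⟩ := exists_tendstoUniformlyOn_of_summable hcont hu
    fun n t ht => hinc n t (mem_ball_zero_iff.mp ht)
  refine ⟨ρ, hρ, g, hg, fun n t ht => hnz n t (mem_ball_zero_iff.mp ht), ?_⟩
  simpa only [norm_fin_two] using hlim
end

section
/- Let d ≥ 1 and let P, Q be polynomials in variables z, w, homogeneous of degree d in (z, w), with coefficients in ℚ[t] and with not all coefficients of P and Q divisible by t. Suppose the homogeneous resultant R(t) = Res(P, Q) ∈ ℚ[t] of P and Q (taken with respect to the variables (z, w) over the ring ℚ[t]) is a nonzero polynomial, and let q be the multiplicity of t = 0 as a root of R. Then there is a finite set S of primes such that for every prime p ∉ S, every t ∈ ℚ with 0 < |t|_p < 1, and every (z, w) ∈ ℚ_p²: |t|_p^q · max(|z|_p, |w|_p)^d ≤ max(|P_t(z,w)|_p, |Q_t(z,w)|_p) ≤ max(|z|_p, |w|_p)^d, where P_t, Q_t are obtained by evaluating the coefficients at t, and |·|_p is the p-adic absolute value normalized so that |p|_p = 1/p. -/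
/-- The coefficient of `z^i w^{d-i}` in a bivariate form `P` (variables `0 ↦ z`, `1 ↦ w`). -/
noncomputable def formCoeff (d : ℕ) (P : MvPolynomial (Fin 2) (Polynomial ℚ)) (i : ℕ) :
    Polynomial ℚ :=
  MvPolynomial.coeff (Finsupp.single (0 : Fin 2) i + Finsupp.single (1 : Fin 2) (d - i)) P

/-- The Sylvester matrix of two coefficient sequences `a`, `b` of binary forms of degree `d`:
a `2d × 2d` matrix whose first `d` rows carry the shifts of `a` and whose last `d` rows
carry the shifts of `b`. -/
noncomputable def sylvester (d : ℕ) (a b : ℕ → Polynomial ℚ) :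
    Matrix (Fin (2 * d)) (Fin (2 * d)) (Polynomial ℚ) :=
  Matrix.of fun i j =>
    if (i : ℕ) < d then
      (if (i : ℕ) ≤ (j : ℕ) ∧ (j : ℕ) ≤ (i : ℕ) + d then a ((j : ℕ) - (i : ℕ)) else 0)
    else
      (if (i : ℕ) - d ≤ (j : ℕ) ∧ (j : ℕ) ≤ ((i : ℕ) - d) + d then
        b ((j : ℕ) - ((i : ℕ) - d)) else 0)

/-- The homogeneous resultant `Res(P,Q) ∈ ℚ[t]` of two binary forms of degree `d`
with coefficients in `ℚ[t]`, as the determinant of their Sylvester matrix. -/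
noncomputable def homResultant (d : ℕ) (P Q : MvPolynomial (Fin 2) (Polynomial ℚ)) :
    Polynomial ℚ :=
  (sylvester d (formCoeff d P) (formCoeff d Q)).det

open Finset in
/-- A binary form of degree `d` evaluates to the sum of its terms `z^k w^{d-k}`. -/
lemma eval₂_binary_form_eq_sum {K : Type*} [CommSemiring K] {d : ℕ}
    {P : MvPolynomial (Fin 2) (Polynomial ℚ)} (hP : P.IsHomogeneous d)
    (φ : Polynomial ℚ →+* K) (z w : K) :
    MvPolynomial.eval₂ φ ![z, w] P =
      ∑ k ∈ range (d + 1), φ (formCoeff d P k) * (z ^ k * w ^ (d - k)) := by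
  have hdeg : ∀ m ∈ P.support, m 0 + m 1 = d := by
    intro m hm
    have h := hP (MvPolynomial.mem_support_iff.mp hm)
    simpa [Finsupp.weight_apply, Finsupp.sum_fintype, Fin.sum_univ_two] using h
  have hmon : ∀ m ∈ P.support,
      Finsupp.single (0 : Fin 2) (m 0) + Finsupp.single (1 : Fin 2) (d - m 0) = m := by
    intro m hm
    have h := hdeg m hm
    ext i
    fin_cases i
    · simp
    · simp
      omega
  rw [MvPolynomial.eval₂_eq']
  refine sum_of_injOn (fun m => m 0) ?_ ?_ ?_ ?_
  · intro m hm m' hm' h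
    rw [← hmon m hm, ← hmon m' hm', show m 0 = m' 0 from h]
  · intro m hm
    have := hdeg m hm
    simp only [coe_range, Set.mem_Iio]
    omega
  · intro k _ hk
    have : formCoeff d P k = 0 := by
      by_contra hne
      exact hk ⟨_, MvPolynomial.mem_support_iff.mpr hne, by simp⟩
    simp [this]
  · intro m hm
    have h := hdeg m hm
    rw [formCoeff, hmon m hm, Fin.prod_univ_two, show d - m 0 = m 1 by omega]
    simp

open Finset in
/-- Multiplying a shifted coefficient row against the vector `(z^j w^{n-1-j})_j` yields
`z^i w^{n-1-d-i}` times the value of the form. -/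
lemma sum_shifted_row_mul_monomial {K : Type*} [CommSemiring K] (n d i : ℕ) (hi : i + d < n)
    (a : ℕ → K) (z w : K) :
    ∑ j : Fin n, (if i ≤ (j : ℕ) ∧ (j : ℕ) ≤ i + d then a (j - i) else 0) *
        (z ^ (j : ℕ) * w ^ (n - 1 - j)) =
      z ^ i * w ^ (n - 1 - d - i) * ∑ k ∈ range (d + 1), a k * (z ^ k * w ^ (d - k)) := by
  rw [Fin.sum_univ_eq_sum_range (fun j => (if i ≤ j ∧ j ≤ i + d then a (j - i) else 0) *
    (z ^ j * w ^ (n - 1 - j))) n]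
  simp only [ite_mul, zero_mul]
  rw [← sum_filter]
  have hfilter : (range n).filter (fun j => i ≤ j ∧ j ≤ i + d) = Ico i (i + (d + 1)) := by
    ext j
    simp only [mem_filter, mem_range, mem_Ico]
    omega
  rw [hfilter, sum_Ico_eq_sum_range, Nat.add_sub_cancel_left, mul_sum]
  refine sum_congr rfl fun k hk => ?_
  have hk := mem_range.mp hk
  rw [Nat.add_sub_cancel_left, pow_add,
    show n - 1 - (i + k) = (n - 1 - d - i) + (d - k) by omega, pow_add]
  ring

lemma norm_pow_mul_pow_le {K : Type*} [NormedField K] (z w : K) (i j : ℕ) :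
    ‖z ^ i * w ^ j‖ ≤ (max ‖z‖ ‖w‖) ^ (i + j) := by
  rw [norm_mul, norm_pow, norm_pow, pow_add]
  gcongr
  · exact le_max_left _ _
  · exact le_max_right _ _

lemma norm_eval₂_binary_form_le {K : Type*} [NormedField K] [IsUltrametricDist K] {d : ℕ}
    {P : MvPolynomial (Fin 2) (Polynomial ℚ)} (hP : P.IsHomogeneous d)
    (φ : Polynomial ℚ →+* K) (hφ : ∀ k, ‖φ (formCoeff d P k)‖ ≤ 1) (z w : K) :
    ‖MvPolynomial.eval₂ φ ![z, w] P‖ ≤ (max ‖z‖ ‖w‖) ^ d := by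
  rw [eval₂_binary_form_eq_sum hP]
  refine IsUltrametricDist.norm_sum_le_of_forall_le_of_nonneg (by positivity) fun k hk => ?_
  have hk := Finset.mem_range.mp hk
  rw [norm_mul]
  calc _ ≤ 1 * (max ‖z‖ ‖w‖) ^ (k + (d - k)) := by
        gcongr
        · exact hφ k
        · exact norm_pow_mul_pow_le z w k (d - k)
    _ = _ := by rw [one_mul, show k + (d - k) = d by omega]

/-- A matrix with `p`-adically integral entries satisfies `‖det M‖ ‖v_j‖ ≤ ‖M v‖_∞`. -/
lemma norm_det_mul_norm_le {p : ℕ} [Fact p.Prime] {n : Type*} [Fintype n] [DecidableEq n]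
    (M : Matrix n n ℚ_[p]) (hM : ∀ i j, ‖M i j‖ ≤ 1) (v : n → ℚ_[p]) {B : ℝ} (hB : 0 ≤ B)
    (h : ∀ i, ‖M.mulVec v i‖ ≤ B) (j : n) : ‖M.det‖ * ‖v j‖ ≤ B := by
  let M' : Matrix n n ℤ_[p] := Matrix.of fun i j => ⟨M i j, hM i j⟩
  have hMM' : M = PadicInt.Coe.ringHom.mapMatrix M' := rfl
  have hadj : ∀ i j, ‖M.adjugate i j‖ ≤ 1 := by
    intro i j
    rw [hMM', ← RingHom.map_adjugate]
    exact (M'.adjugate i j).2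
  have hv : M.adjugate.mulVec (M.mulVec v) j = M.det * v j := by
    rw [Matrix.mulVec_mulVec, Matrix.adjugate_mul, Matrix.smul_mulVec, Matrix.one_mulVec]
    rfl
  rw [← norm_mul, ← hv]
  refine IsUltrametricDist.norm_sum_le_of_forall_le_of_nonneg hB fun i _ => ?_
  rw [norm_mul]
  exact (mul_le_mul (hadj j i) (h i) (norm_nonneg _) zero_le_one).trans_eq (one_mul B)

/-- The resultant bounds the values of a pair of integral binary forms from below. -/
lemma norm_homResultant_mul_le {p : ℕ} [Fact p.Prime] {d : ℕ} (hd : 1 ≤ d)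
    {P Q : MvPolynomial (Fin 2) (Polynomial ℚ)} (hP : P.IsHomogeneous d) (hQ : Q.IsHomogeneous d)
    (φ : Polynomial ℚ →+* ℚ_[p]) (hφP : ∀ k, ‖φ (formCoeff d P k)‖ ≤ 1)
    (hφQ : ∀ k, ‖φ (formCoeff d Q k)‖ ≤ 1) (z w : ℚ_[p]) :
    ‖φ (homResultant d P Q)‖ * (max ‖z‖ ‖w‖) ^ d ≤
      max ‖MvPolynomial.eval₂ φ ![z, w] P‖ ‖MvPolynomial.eval₂ φ ![z, w] Q‖ := by
  set N := max ‖z‖ ‖w‖ with hN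
  set B := max ‖MvPolynomial.eval₂ φ ![z, w] P‖ ‖MvPolynomial.eval₂ φ ![z, w] Q‖
  have hB : 0 ≤ B := (norm_nonneg _).trans (le_max_left _ _)
  have hN0 : 0 ≤ N := (norm_nonneg _).trans (le_max_left _ _)
  rcases hN0.eq_or_lt with h0 | hNpos
  · rw [← h0, zero_pow (by omega), mul_zero]
    exact hB
  set M := φ.mapMatrix (sylvester d (formCoeff d P) (formCoeff d Q)) with hM
  let v : Fin (2 * d) → ℚ_[p] := fun j => z ^ (j : ℕ) * w ^ (2 * d - 1 - j)
  have hdet : φ (homResultant d P Q) = M.det := RingHom.map_det _ _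
  have hentry : ∀ i j, ‖M i j‖ ≤ 1 := by
    intro i j
    simp only [hM, sylvester, RingHom.mapMatrix_apply, Matrix.map_apply, Matrix.of_apply]
    split_ifs <;> simp [hφP, hφQ]
  have hrow : ∀ i, ‖M.mulVec v i‖ ≤ N ^ (d - 1) * B := by
    intro i
    have hshift : ∀ (F : MvPolynomial (Fin 2) (Polynomial ℚ)) (_ : F.IsHomogeneous d)
        (_ : ‖MvPolynomial.eval₂ φ ![z, w] F‖ ≤ B) (r : ℕ) (_ : r < d),
        ‖∑ j : Fin (2 * d), (if r ≤ (j : ℕ) ∧ (j : ℕ) ≤ r + d then φ (formCoeff d F (j - r))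
          else 0) * v j‖ ≤ N ^ (d - 1) * B := by
      intro F hF hFB r hr
      rw [sum_shifted_row_mul_monomial (2 * d) d r (by omega) (fun k => φ (formCoeff d F k)) z w,
        ← eval₂_binary_form_eq_sum hF, norm_mul]
      gcongr
      refine (norm_pow_mul_pow_le z w _ _).trans_eq ?_
      rw [show r + (2 * d - 1 - d - r) = d - 1 by omega]
    by_cases hi : (i : ℕ) < d
    · convert hshift P hP (le_max_left _ _) i hi using 2
      simp only [Matrix.mulVec, dotProduct, hM, sylvester, RingHom.mapMatrix_apply,
        Matrix.map_apply, Matrix.of_apply, if_pos hi, apply_ite φ, map_zero]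
    · convert hshift Q hQ (le_max_right _ _) (i - d) (by omega) using 2
      simp only [Matrix.mulVec, dotProduct, hM, sylvester, RingHom.mapMatrix_apply,
        Matrix.map_apply, Matrix.of_apply, if_neg hi, apply_ite φ, map_zero]
  have hbound := norm_det_mul_norm_le M hentry v (mul_nonneg (pow_nonneg hN0 _) hB) hrow
  have hmax : ‖M.det‖ * N ^ (2 * d - 1) ≤ N ^ (d - 1) * B := by
    rcases le_total ‖z‖ ‖w‖ with h | h
    · have := hbound ⟨0, by omega⟩
      simpa [v, hN, max_eq_right h] using this
    · have := hbound ⟨2 * d - 1, by omega⟩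
      simpa [v, hN, max_eq_left h] using this
  rw [hdet]
  refine le_of_mul_le_mul_left ?_ (pow_pos hNpos (d - 1))
  rw [show 2 * d - 1 = (d - 1) + d by omega, pow_add] at hmax
  linarith

lemma norm_eval₂_le_one {p : ℕ} [Fact p.Prime] {f : Polynomial ℚ}
    (hf : ∀ i, ‖((f.coeff i : ℚ) : ℚ_[p])‖ ≤ 1) {t : ℚ_[p]} (ht : ‖t‖ ≤ 1) :
    ‖Polynomial.eval₂ (algebraMap ℚ ℚ_[p]) t f‖ ≤ 1 := by
  rw [Polynomial.eval₂_eq_sum_range]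
  refine IsUltrametricDist.norm_sum_le_of_forall_le_of_nonneg zero_le_one fun i _ => ?_
  rw [norm_mul, norm_pow, eq_ratCast]
  exact mul_le_one₀ (hf i) (by positivity) (pow_le_one₀ (norm_nonneg _) ht)

lemma norm_eval₂_eq_one {p : ℕ} [Fact p.Prime] {f : Polynomial ℚ}
    (hf : ∀ i, ‖((f.coeff i : ℚ) : ℚ_[p])‖ ≤ 1) (hf0 : ‖((f.coeff 0 : ℚ) : ℚ_[p])‖ = 1)
    {t : ℚ_[p]} (ht : ‖t‖ < 1) :
    ‖Polynomial.eval₂ (algebraMap ℚ ℚ_[p]) t f‖ = 1 := by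
  have hdiv : ‖t * Polynomial.eval₂ (algebraMap ℚ ℚ_[p]) t f.divX‖ < 1 := by
    rw [norm_mul]
    refine lt_of_le_of_lt (mul_le_of_le_one_right (norm_nonneg _) ?_) ht
    exact norm_eval₂_le_one (fun i => by simpa using hf (i + 1)) ht.le
  conv_lhs => rw [← f.X_mul_divX_add]
  rw [Polynomial.eval₂_add, Polynomial.eval₂_mul, Polynomial.eval₂_X, Polynomial.eval₂_C,
    eq_ratCast, IsUltrametricDist.norm_add_eq_max_of_norm_ne_norm (by rw [hf0]; exact hdiv.ne),
    hf0, max_eq_right hdiv.le]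

lemma norm_ratCast_le_one_of_notMem_primeFactors {p : ℕ} [hp : Fact p.Prime] {r : ℚ}
    (h : p ∉ r.den.primeFactors) : ‖(r : ℚ_[p])‖ ≤ 1 :=
  Padic.norm_rat_le_one fun hdvd => h (Nat.mem_primeFactors.mpr ⟨hp.out, hdvd, r.den_nz⟩)

/-- The primes dividing a denominator of some coefficient of `f`. -/
def denPrimes (f : Polynomial ℚ) : Finset ℕ :=
  f.support.biUnion fun i => (f.coeff i).den.primeFactors

lemma norm_coeff_le_one_of_notMem_denPrimes {p : ℕ} [Fact p.Prime] {f : Polynomial ℚ}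
    (h : p ∉ denPrimes f) (i : ℕ) : ‖((f.coeff i : ℚ) : ℚ_[p])‖ ≤ 1 := by
  by_cases hi : f.coeff i = 0
  · simp [hi]
  · exact norm_ratCast_le_one_of_notMem_primeFactors fun hmem =>
      h (Finset.mem_biUnion.mpr ⟨i, Polynomial.mem_support_iff.mpr hi, hmem⟩)

lemma norm_eval₂_formCoeff_le_one {p : ℕ} [Fact p.Prime]
    {P : MvPolynomial (Fin 2) (Polynomial ℚ)}
    (h : p ∉ P.support.biUnion fun m => denPrimes (P.coeff m)) {t : ℚ_[p]} (ht : ‖t‖ ≤ 1)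
    (d k : ℕ) : ‖Polynomial.eval₂RingHom (algebraMap ℚ ℚ_[p]) t (formCoeff d P k)‖ ≤ 1 := by
  by_cases hk : formCoeff d P k = 0
  · simp [hk]
  · refine norm_eval₂_le_one (norm_coeff_le_one_of_notMem_denPrimes fun hmem => h ?_) ht
    exact Finset.mem_biUnion.mpr ⟨_, MvPolynomial.mem_support_iff.mpr hk, hmem⟩

/-- the two-sided bound
`|t|_p^q · ‖(z,w)‖^d ≤ ‖F_t(z,w)‖_p ≤ ‖(z,w)‖^d` for all primes `p` outside a finite
set, all `t ∈ ℚ` with `0 < |t|_p < 1` and all `(z,w) ∈ ℚ_p²`, where `q` is the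
multiplicity of `t = 0` as a root of the (nonzero) homogeneous resultant of `(P, Q)`. -/
theorem stmt_7 (d : ℕ) (hd : 1 ≤ d)
    (P Q : MvPolynomial (Fin 2) (Polynomial ℚ))
    (hP : P.IsHomogeneous d) (hQ : Q.IsHomogeneous d)
    (hcoeff : ¬((∀ m, Polynomial.X ∣ MvPolynomial.coeff m P) ∧
               (∀ m, Polynomial.X ∣ MvPolynomial.coeff m Q)))
    (hres : homResultant d P Q ≠ 0)
    (q : ℕ) (hq : q = (homResultant d P Q).rootMultiplicity 0) :
    ∃ S : Finset ℕ, ∀ (p : ℕ) [Fact p.Prime], p ∉ S →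
      ∀ t : ℚ, 0 < ‖((t : ℚ) : ℚ_[p])‖ → ‖((t : ℚ) : ℚ_[p])‖ < 1 →
        ∀ z w : ℚ_[p],
          ‖((t : ℚ) : ℚ_[p])‖ ^ q * (max ‖z‖ ‖w‖) ^ d ≤
            max ‖MvPolynomial.eval₂
                  (Polynomial.eval₂RingHom (algebraMap ℚ ℚ_[p]) ((t : ℚ) : ℚ_[p])) ![z, w] P‖
                ‖MvPolynomial.eval₂
                  (Polynomial.eval₂RingHom (algebraMap ℚ ℚ_[p]) ((t : ℚ) : ℚ_[p])) ![z, w] Q‖ ∧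
          max ‖MvPolynomial.eval₂
                  (Polynomial.eval₂RingHom (algebraMap ℚ ℚ_[p]) ((t : ℚ) : ℚ_[p])) ![z, w] P‖
              ‖MvPolynomial.eval₂
                  (Polynomial.eval₂RingHom (algebraMap ℚ ℚ_[p]) ((t : ℚ) : ℚ_[p])) ![z, w] Q‖ ≤
            (max ‖z‖ ‖w‖) ^ d := by
  obtain ⟨g, hg, hXg⟩ := Polynomial.exists_eq_pow_rootMultiplicity_mul_and_not_dvd _ hres 0
  rw [← hq, Polynomial.C_0, sub_zero] at hg
  rw [Polynomial.C_0, sub_zero, Polynomial.X_dvd_iff] at hXg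
  refine ⟨(P.support.biUnion fun m => denPrimes (P.coeff m)) ∪
    (Q.support.biUnion fun m => denPrimes (Q.coeff m)) ∪
    (denPrimes g ∪ ((g.coeff 0)⁻¹).den.primeFactors), fun p _ hp t _ ht z w => ?_⟩
  simp only [Finset.notMem_union] at hp
  obtain ⟨⟨hpP, hpQ⟩, hpg, hpg0⟩ := hp
  have hcP := norm_eval₂_formCoeff_le_one hpP ht.le d
  have hcQ := norm_eval₂_formCoeff_le_one hpQ ht.le d
  have hgcoeff := norm_coeff_le_one_of_notMem_denPrimes hpg
  have hg0 : ‖((g.coeff 0 : ℚ) : ℚ_[p])‖ = 1 := by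
    refine le_antisymm (hgcoeff 0) ?_
    have hinv := norm_ratCast_le_one_of_notMem_primeFactors hpg0
    rw [Rat.cast_inv, norm_inv] at hinv
    exact (inv_le_one₀ (norm_pos_iff.mpr (Rat.cast_ne_zero.mpr hXg))).mp hinv
  have hR : ‖Polynomial.eval₂RingHom (algebraMap ℚ ℚ_[p]) (t : ℚ_[p]) (homResultant d P Q)‖ =
      ‖(t : ℚ_[p])‖ ^ q := by
    rw [hg, map_mul, map_pow, norm_mul, norm_pow, Polynomial.coe_eval₂RingHom,
      Polynomial.eval₂_X, norm_eval₂_eq_one hgcoeff hg0 ht, mul_one]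
  refine ⟨?_, max_le (norm_eval₂_binary_form_le hP _ hcP z w)
    (norm_eval₂_binary_form_le hQ _ hcQ z w)⟩
  rw [← hR]
  exact norm_homResultant_mul_le hd hP hQ _ hcP hcQ z w
end

section
/- Let F : (ℚ[t])² → (ℚ[t])² be defined by F(z, w) = (z·(z + w), (z + t·w)·w), let A = (1, 1), and for n ≥ 0 let A_n = Fⁿ(A) ∈ (ℚ[t])², the n-th iterate of F applied to A. Then: (a) for every n ≥ 0, the evaluation A_n(0) ∈ ℚ² is not (0,0) and the evaluation A_n(1) ∈ ℚ² is not (0,0); and (b) for every prime p, writing A_n(0) = (x_n, y_n) ∈ ℚ², the limit α_p := lim_{n→∞} 2^{−n} · log max(|x_n|_p, |y_n|_p) exists in ℝ and is strictly negative. -/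
open Filter Topology

/-- The homogeneous lift `F(z,w) = (z(z+w), (z+tw)w)` of `f(z) = z(z+1)/(z+t)`,
acting on `(ℚ[t])²`. -/
noncomputable def Fex : (Fin 2 → Polynomial ℚ) → (Fin 2 → Polynomial ℚ) :=
  fun x => ![x 0 * (x 0 + x 1), (x 0 + Polynomial.X * x 1) * x 1]

theorem eval_Fex_iterate_succ (t : ℚ) (n : ℕ) :
    ((Fex^[n + 1] ![1, 1]) 0).eval t = ((Fex^[n] ![1, 1]) 0).eval t *
        (((Fex^[n] ![1, 1]) 0).eval t + ((Fex^[n] ![1, 1]) 1).eval t) ∧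
      ((Fex^[n + 1] ![1, 1]) 1).eval t = (((Fex^[n] ![1, 1]) 0).eval t +
        t * ((Fex^[n] ![1, 1]) 1).eval t) * ((Fex^[n] ![1, 1]) 1).eval t := by
  rw [Function.iterate_succ_apply']
  simp [Fex]

theorem eval_Fex_iterate_pos {t : ℚ} (ht : 0 ≤ t) (n : ℕ) :
    0 < ((Fex^[n] ![1, 1]) 0).eval t ∧ 0 < ((Fex^[n] ![1, 1]) 1).eval t := by
  induction n with
  | zero => simp
  | succ n ih =>
    obtain ⟨hx, hy⟩ := ih
    rw [(eval_Fex_iterate_succ t n).1, (eval_Fex_iterate_succ t n).2]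
    constructor <;> positivity

/-- At `t = 0` the map `f` is the translation `z ↦ z + 1`. -/
theorem eval_zero_Fex_iterate_fst (n : ℕ) :
    ((Fex^[n] ![1, 1]) 0).eval 0 = ((n + 1 : ℕ) : ℚ) * ((Fex^[n] ![1, 1]) 1).eval 0 := by
  induction n with
  | zero => simp
  | succ n ih =>
    rw [(eval_Fex_iterate_succ 0 n).1, (eval_Fex_iterate_succ 0 n).2, ih]
    push_cast
    ring

theorem eval_zero_Fex_iterate_snd_succ (n : ℕ) :
    ((Fex^[n + 1] ![1, 1]) 1).eval 0 =
      ((n + 1 : ℕ) : ℚ) * ((Fex^[n] ![1, 1]) 1).eval 0 ^ 2 := by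
  rw [(eval_Fex_iterate_succ 0 n).2, eval_zero_Fex_iterate_fst]
  ring

theorem max_padicNorm_eval_zero_Fex_iterate (p : ℕ) [Fact p.Prime] (n : ℕ) :
    max (padicNorm p (((Fex^[n] ![1, 1]) 0).eval 0) : ℝ)
        (padicNorm p (((Fex^[n] ![1, 1]) 1).eval 0) : ℝ) =
      (padicNorm p (((Fex^[n] ![1, 1]) 1).eval 0) : ℝ) := by
  apply max_eq_right
  rw [eval_zero_Fex_iterate_fst, padicNorm.mul]
  exact_mod_cast mul_le_of_le_one_left (padicNorm.nonneg _) (padicNorm.of_nat (n + 1))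

theorem log_padicNorm_natCast (p : ℕ) [Fact p.Prime] {m : ℕ} (hm : m ≠ 0) :
    Real.log (padicNorm p (m : ℚ) : ℝ) = -(padicValNat p m * Real.log p) := by
  rw [padicNorm.eq_zpow_of_nonzero (by exact_mod_cast hm), padicValRat.of_nat,
    Rat.cast_zpow, Rat.cast_natCast, Real.log_zpow, Int.cast_neg, Int.cast_natCast, neg_mul]

theorem log_padicNorm_eval_zero_Fex_iterate (p : ℕ) [Fact p.Prime] (n : ℕ) :
    ((2 : ℝ) ^ n)⁻¹ * Real.log (padicNorm p (((Fex^[n] ![1, 1]) 1).eval 0) : ℝ) =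
      -∑ k ∈ Finset.range n, padicValNat p (k + 1) * Real.log p / 2 ^ (k + 1) := by
  induction n with
  | zero => simp
  | succ n ih =>
    have hy : (padicNorm p (((Fex^[n] ![1, 1]) 1).eval 0) : ℝ) ≠ 0 := by
      exact_mod_cast padicNorm.nonzero (eval_Fex_iterate_pos le_rfl n).2.ne'
    have hn : (padicNorm p ((n + 1 : ℕ) : ℚ) : ℝ) ≠ 0 := by
      exact_mod_cast padicNorm.nonzero (p := p) (q := ((n + 1 : ℕ) : ℚ))
        (Nat.cast_ne_zero.mpr n.succ_ne_zero)
    rw [Finset.sum_range_succ, neg_add, ← ih, eval_zero_Fex_iterate_snd_succ, pow_two,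
      padicNorm.mul, padicNorm.mul, Rat.cast_mul, Rat.cast_mul,
      Real.log_mul hn (mul_ne_zero hy hy), Real.log_mul hy hy,
      log_padicNorm_natCast p n.succ_ne_zero]
    field_simp
    ring

theorem summable_padicValNat_div_two_pow (p : ℕ) :
    Summable fun k : ℕ => padicValNat p (k + 1) * Real.log p / 2 ^ (k + 1) := by
  have hgeom : Summable fun k : ℕ => (k : ℝ) ^ 1 * (1 / 2 : ℝ) ^ k :=
    summable_pow_mul_geometric_of_norm_lt_one 1 (by norm_num)
  refine Summable.of_nonneg_of_le (fun k => by positivity) (fun k => ?_)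
    (((summable_nat_add_iff 1).mpr hgeom).mul_left (Real.log p))
  have hval : (padicValNat p (k + 1) : ℝ) ≤ ((k + 1 : ℕ) : ℝ) := by
    exact_mod_cast (padicValNat_le_nat_log (k + 1)).trans (Nat.log_le_self p (k + 1))
  calc padicValNat p (k + 1) * Real.log p / 2 ^ (k + 1)
      ≤ ((k + 1 : ℕ) : ℝ) * Real.log p / 2 ^ (k + 1) := by gcongr
    _ = Real.log p * (((k + 1 : ℕ) : ℝ) ^ 1 * (1 / 2 : ℝ) ^ (k + 1)) := by
      rw [one_div, inv_pow]
      ring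

/-- for `F(z,w) = (z(z+w), (z+tw)w)` and `A = (1,1)`:
(a) the specializations of `A_n = Fⁿ(A)` at `t = 0` and `t = 1` are never `(0,0)`;
(b) for every prime `p`, the limit `α_p = lim 2^{-n} log ‖A_n(0)‖_p` exists and is
strictly negative. -/
theorem stmt_10 :
    (∀ n : ℕ,
      ¬((((Fex^[n] ![1, 1]) 0).eval 0 = 0) ∧ (((Fex^[n] ![1, 1]) 1).eval 0 = 0)) ∧
      ¬((((Fex^[n] ![1, 1]) 0).eval 1 = 0) ∧ (((Fex^[n] ![1, 1]) 1).eval 1 = 0))) ∧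
    (∀ p : ℕ, p.Prime → ∃ α : ℝ, α < 0 ∧
      Tendsto (fun n : ℕ => ((2 : ℝ) ^ n)⁻¹ *
          Real.log (max (padicNorm p (((Fex^[n] ![1, 1]) 0).eval 0) : ℝ)
                        (padicNorm p (((Fex^[n] ![1, 1]) 1).eval 0) : ℝ)))
        atTop (𝓝 α)) := by
  refine ⟨fun n => ⟨fun h => (eval_Fex_iterate_pos le_rfl n).1.ne' h.1,
    fun h => (eval_Fex_iterate_pos zero_le_one n).1.ne' h.1⟩, fun p hp => ?_⟩
  have : Fact p.Prime := ⟨hp⟩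
  have hsum := summable_padicValNat_div_two_pow p
  refine ⟨-∑' k : ℕ, padicValNat p (k + 1) * Real.log p / 2 ^ (k + 1), ?_, ?_⟩
  · refine neg_neg_of_pos (hsum.tsum_pos (fun k => by positivity) (p - 1) ?_)
    have hlog : 0 < Real.log p := Real.log_pos (by exact_mod_cast hp.one_lt)
    rw [Nat.sub_add_cancel hp.one_le, padicValNat_self]
    positivity
  · simp_rw [max_padicNorm_eval_zero_Fex_iterate, log_padicNorm_eval_zero_Fex_iterate]
    exact hsum.hasSum.tendsto_sum_nat.neg
end

section
/- Let F : (ℚ[t])² → (ℚ[t])² be defined by F(z, w) = (z·(z + w), (z + t·w)·w), let A = (1, 1), and for n ≥ 0 write Fⁿ(A) = (x_n(t), y_n(t)) ∈ (ℚ[t])² for the n-th iterate of F applied to A. Then x_n and y_n are nonzero polynomials for every n, and lim_{n→∞} 2^{−n} · max(deg x_n, deg y_n) = 1. -/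
open Filter Topology

open Polynomial in
/-- Along the orbit of `(1, 1)` both components are positive at `t = 1`, and the second has degree
exactly `2 ^ n - 1`, which bounds the degree of the first. -/
theorem Fex_iterate_invariant (n : ℕ) :
    0 < ((Fex^[n] ![1, 1]) 0).eval 1 ∧ 0 < ((Fex^[n] ![1, 1]) 1).eval 1 ∧
    ((Fex^[n] ![1, 1]) 0).natDegree ≤ ((Fex^[n] ![1, 1]) 1).natDegree ∧
    ((Fex^[n] ![1, 1]) 1).natDegree + 1 = 2 ^ n := by
  induction n with
  | zero => simp
  | succ n ih =>
    rw [Function.iterate_succ_apply']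
    generalize Fex^[n] ![1, 1] = p at ih ⊢
    obtain ⟨hx, hy, hle, hdeg⟩ := ih
    have hy0 : p 1 ≠ 0 := by
      intro h
      simp [h] at hy
    have hX : (X * p 1).natDegree = (p 1).natDegree + 1 := natDegree_X_mul hy0
    have hsum : (p 0 + X * p 1).natDegree = (p 1).natDegree + 1 := by
      rw [natDegree_add_eq_right_of_natDegree_lt (by omega), hX]
    have hsum0 : p 0 + X * p 1 ≠ 0 := by
      intro h
      simp [h] at hsum
    have hsnd : ((p 0 + X * p 1) * p 1).natDegree = (p 1).natDegree + 1 + (p 1).natDegree := by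
      rw [natDegree_mul hsum0 hy0, hsum]
    have hfst : (p 0 * (p 0 + p 1)).natDegree ≤ (p 1).natDegree + (p 1).natDegree :=
      natDegree_mul_le_of_le hle (natDegree_add_le_of_degree_le hle le_rfl)
    simp only [Fex, Matrix.cons_val_zero, Matrix.cons_val_one, eval_mul, eval_add, eval_X, one_mul]
    refine ⟨by positivity, by positivity, by omega, ?_⟩
    rw [hsnd, pow_succ]
    omega

/-- for `F(z,w) = (z(z+w), (z+tw)w)` and `A = (1,1)`, the components
`x_n, y_n ∈ ℚ[t]` of `Fⁿ(A)` are nonzero and `2^{-n} max(deg x_n, deg y_n) → 1`,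
i.e. the geometric escape rate at `t = ∞` equals `1`. -/
theorem stmt_11 :
    (∀ n : ℕ, (Fex^[n] ![1, 1]) 0 ≠ 0 ∧ (Fex^[n] ![1, 1]) 1 ≠ 0) ∧
    Tendsto (fun n : ℕ => ((2 : ℝ) ^ n)⁻¹ *
        ((max ((Fex^[n] ![1, 1]) 0).natDegree ((Fex^[n] ![1, 1]) 1).natDegree : ℕ) : ℝ))
      atTop (𝓝 1) := by
  refine ⟨fun n => ?_, ?_⟩
  · obtain ⟨hx, hy, -, -⟩ := Fex_iterate_invariant n
    refine ⟨fun h => ?_, fun h => ?_⟩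
    · simp [h] at hx
    · simp [h] at hy
  · have hlim : Tendsto (fun n : ℕ => 1 - ((2 : ℝ)⁻¹) ^ n) atTop (𝓝 1) := by
      simpa using (tendsto_pow_atTop_nhds_zero_of_lt_one (r := (2 : ℝ)⁻¹)
        (by norm_num) (by norm_num)).const_sub 1
    refine hlim.congr fun n => ?_
    obtain ⟨-, -, hle, hdeg⟩ := Fex_iterate_invariant n
    have hcast : (((Fex^[n] ![1, 1]) 1).natDegree : ℝ) = 2 ^ n - 1 :=
      eq_sub_of_add_eq (by exact_mod_cast hdeg)
    rw [max_eq_right hle, hcast, inv_pow]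
    field_simp
end

section
/- Let d ≥ 3 be an integer and define φ(a) = (a^d + t)/a for nonzero a in the rational function field ℚ(t). Then for every nonzero a ∈ ℚ(t): φⁿ(a) is defined and nonzero for every n ≥ 0 (i.e., the orbit never hits 0), and intDeg(φⁿ(a)) → +∞ as n → ∞, where for a rational function r = f/g in lowest terms, intDeg(r) := deg f − deg g. -/
open Filter Topology

namespace RatFunc

variable {K : Type*} [Field K]

lemma add_ne_zero_of_intDegree_ne {x y : RatFunc K} (h : x.intDegree ≠ y.intDegree) :
    x + y ≠ 0 := by
  intro hxy
  rw [eq_neg_of_add_eq_zero_left hxy, intDegree_neg] at h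
  exact h rfl

lemma intDegree_add_eq_right {x y : RatFunc K} (hx : x ≠ 0) (hy : y ≠ 0)
    (h : x.intDegree < y.intDegree) : (x + y).intDegree = y.intDegree := by
  have hxy := add_ne_zero_of_intDegree_ne h.ne
  have upper := intDegree_add_le hy hxy
  have lower := intDegree_add_le (x := x + y) (y := -x) (neg_ne_zero.mpr hx) (by simpa using hy)
  rw [add_neg_cancel_comm, intDegree_neg] at lower
  omega

lemma intDegree_add_eq_max {x y : RatFunc K} (hx : x ≠ 0) (hy : y ≠ 0)
    (h : x.intDegree ≠ y.intDegree) :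
    (x + y).intDegree = max x.intDegree y.intDegree := by
  rcases h.lt_or_gt with h | h
  · rw [intDegree_add_eq_right hx hy h, max_eq_right h.le]
  · rw [add_comm, intDegree_add_eq_right hy hx h, max_eq_left h.le]

lemma intDegree_pow {x : RatFunc K} (hx : x ≠ 0) (n : ℕ) :
    (x ^ n).intDegree = n * x.intDegree := by
  induction n with
  | zero => simp
  | succ n ih =>
    rw [pow_succ, intDegree_mul (pow_ne_zero n hx) hx, ih]
    push_cast
    ring

lemma intDegree_pow_ne_intDegree_X {d : ℕ} (hd : 2 ≤ d) {a : RatFunc K} (ha : a ≠ 0) :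
    (a ^ d).intDegree ≠ (X : RatFunc K).intDegree := by
  rw [intDegree_pow ha, intDegree_X]
  intro h
  have := Int.eq_one_or_neg_one_of_mul_eq_one h
  omega

lemma pow_add_X_div_self_ne_zero {d : ℕ} (hd : 2 ≤ d) {a : RatFunc K} (ha : a ≠ 0) :
    (a ^ d + X) / a ≠ 0 :=
  div_ne_zero (add_ne_zero_of_intDegree_ne (intDegree_pow_ne_intDegree_X hd ha)) ha

lemma intDegree_pow_add_X_div_self {d : ℕ} (hd : 2 ≤ d) {a : RatFunc K} (ha : a ≠ 0) :
    ((a ^ d + X) / a).intDegree = max (d * a.intDegree) 1 - a.intDegree := by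
  have h := intDegree_pow_ne_intDegree_X hd ha
  rw [intDegree_div (add_ne_zero_of_intDegree_ne h) ha,
    intDegree_add_eq_max (pow_ne_zero d ha) X_ne_zero h, intDegree_pow ha, intDegree_X]

/-- The map `a ↦ (a ^ d + X) / a` strictly increases the degree, and its values have positive
degree. -/
lemma max_intDegree_zero_lt_intDegree_pow_add_X_div_self {d : ℕ} (hd : 3 ≤ d) {a : RatFunc K}
    (ha : a ≠ 0) : max a.intDegree 0 < ((a ^ d + X) / a).intDegree := by
  rw [intDegree_pow_add_X_div_self (by omega) ha]
  rcases le_or_gt a.intDegree 0 with h | h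
  · have := le_max_right (d * a.intDegree) 1
    omega
  · have : 3 * a.intDegree ≤ d * a.intDegree := by gcongr; exact_mod_cast hd
    omega

end RatFunc

/-- for `φ(a) = (a^d + t)/a` with `d ≥ 3` over `ℚ(t)`, every nonzero
`a ∈ ℚ(t)` has orbit avoiding `0`, and `intDeg(φⁿ(a)) → +∞`; i.e. every nonzero point
is attracted to the superattracting fixed point at `z = ∞` at the place `t = ∞`. -/
theorem stmt_12 (d : ℕ) (hd : 3 ≤ d) (φ : RatFunc ℚ → RatFunc ℚ)
    (hφ : ∀ a : RatFunc ℚ, φ a = (a ^ d + RatFunc.X) / a) :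
    ∀ a : RatFunc ℚ, a ≠ 0 →
      (∀ n : ℕ, φ^[n] a ≠ 0) ∧
      Tendsto (fun n : ℕ => (φ^[n] a).intDegree) atTop atTop := by
  intro a ha
  have orbit_ne_zero : ∀ n : ℕ, φ^[n] a ≠ 0 := by
    intro n
    induction n with
    | zero => exact ha
    | succ n ih =>
      rw [Function.iterate_succ_apply', hφ]
      exact RatFunc.pow_add_X_div_self_ne_zero (by omega) ih
  refine ⟨orbit_ne_zero, ?_⟩
  have step (n : ℕ) : max (φ^[n] a).intDegree 0 < (φ^[n + 1] a).intDegree := by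
    rw [Function.iterate_succ_apply', hφ]
    exact RatFunc.max_intDegree_zero_lt_intDegree_pow_add_X_div_self hd (orbit_ne_zero n)
  have growth (n : ℕ) : (n : ℤ) ≤ (φ^[n + 1] a).intDegree := by
    induction n with
    | zero => have := step 0; omega
    | succ n ih => have := step (n + 1); omega
  rw [← tendsto_add_atTop_iff_nat 1]
  exact tendsto_atTop_mono growth tendsto_natCast_atTop_atTop
end

section
/- Let p be a prime, let d ≥ 2 and q ≥ 0 be integers, and let P, Q be polynomials in (z, w), homogeneous of degree d, with coefficients in ℤ_p[t]; for t₀ ∈ ℚ_p let F_{t₀} : ℚ_p² → ℚ_p² be the map obtained by evaluating the coefficients at t = t₀, and write ‖(z,w)‖ = max(|z|_p, |w|_p). Assume |t|_p^q · ‖x‖^d ≤ ‖F_t(x)‖ for every t ∈ ℚ_p with 0 < |t|_p < 1 and every x ∈ ℚ_p². Let A ∈ (ℤ_p[t])² with ‖A(0)‖ = 1, and assume that F₀ⁿ(A(0)) ≠ (0,0) for all n ≥ 0 and that α := lim_{n→∞} d^{−n} · log ‖F₀ⁿ(A(0))‖ exists in ℝ. Then for every t ∈ ℚ_p with |t|_p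 < 1, the limit g(t) := lim_{n→∞} d^{−n} · log ‖F_tⁿ(A(t))‖ exists in ℝ and satisfies (d·q + 1)·α ≤ g(t) ≤ 0. -/
open Filter Topology

/-- Evaluation of a polynomial with `ℤ_p` coefficients at a point `t ∈ ℚ_p`. -/
noncomputable def zpEval (p : ℕ) [Fact p.Prime] (t : ℚ_[p]) (a : Polynomial (PadicInt p)) :
    ℚ_[p] :=
  Polynomial.eval₂ (PadicInt.Coe.ringHom) t a

/-- The real-variable core: the escape rate of an orbit `a` which agrees with the reference orbit
`b` as long as the latter stays above the threshold `L`. -/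
theorem exists_tendsto_and_le_of_eq_of_lt {d q : ℕ} (hd : 2 ≤ d) {a b : ℕ → ℝ} {L α : ℝ}
    (hL : L < 0) (hb0 : b 0 = 0) (ha : ∀ n, a (n + 1) ≤ d * a n)
    (hb : ∀ n, b (n + 1) ≤ d * b n) (hlow : ∀ n, q * L + d * a n ≤ a (n + 1))
    (hab : ∀ n, L < b n → a n = b n)
    (hα : Tendsto (fun n => ((d : ℝ) ^ n)⁻¹ * b n) atTop (𝓝 α)) :
    ∃ g : ℝ, Tendsto (fun n => ((d : ℝ) ^ n)⁻¹ * a n) atTop (𝓝 g) ∧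
      ((d : ℝ) * q + 1) * α ≤ g ∧ g ≤ 0 := by
  have hd2 : (2 : ℝ) ≤ d := by exact_mod_cast hd
  have hq : (0 : ℝ) ≤ q := q.cast_nonneg
  have hpos : ∀ n, (0 : ℝ) < (d : ℝ) ^ n := fun n => by positivity
  have anti : ∀ c : ℕ → ℝ, (∀ n, c (n + 1) ≤ d * c n) →
      Antitone (fun n => ((d : ℝ) ^ n)⁻¹ * c n) := by
    refine fun c hc => antitone_nat_of_succ_le fun n => ?_
    calc ((d : ℝ) ^ (n + 1))⁻¹ * c (n + 1) ≤ ((d : ℝ) ^ (n + 1))⁻¹ * (d * c n) := by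
          gcongr; exact hc n
      _ = ((d : ℝ) ^ n)⁻¹ * c n := by field_simp; ring
  have hαb : ∀ n, α ≤ ((d : ℝ) ^ n)⁻¹ * b n := (anti b hb).le_of_tendsto hα
  have hα0 : α ≤ 0 := by simpa [hb0] using hαb 0
  by_cases hall : ∀ n, L < b n
  · have hdq : (d : ℝ) * q * α ≤ 0 := mul_nonpos_of_nonneg_of_nonpos (by positivity) hα0
    refine ⟨α, ?_, by linarith, hα0⟩
    simpa only [funext fun n => hab n (hall n)] using hα
  · push Not at hall
    classical
    have hN := Nat.find_spec hall
    have hmin := fun m => Nat.find_min hall (m := m)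
    generalize Nat.find hall = N at hN hmin
    obtain _ | M := N
    · linarith
    have haM : a M = b M := hab M (not_le.1 (hmin M (Nat.lt_succ_self M)))
    have hstep : ∀ k, d ^ k * a M + q * L * (d ^ k - 1) ≤ a (M + k) := by
      intro k
      induction k with
      | zero => simp
      | succ k ih =>
        have h1 := hlow (M + k)
        have h2 := mul_le_mul_of_nonneg_left ih (by linarith : (0 : ℝ) ≤ d)
        have h3 : q * L * (d - 2) ≤ 0 := mul_nonpos_of_nonpos_of_nonneg
          (mul_nonpos_of_nonneg_of_nonpos hq hL.le) (by linarith)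
        rw [← add_assoc, pow_succ]
        linarith
    have hbdd : ∀ k, ((d : ℝ) * q + 1) * α ≤ ((d : ℝ) ^ (M + k))⁻¹ * a (M + k) := by
      intro k
      rw [inv_mul_eq_div, le_div_iff₀ (hpos _)]
      have h1 := hαb M
      have h2 := (hαb (M + 1)).trans (mul_le_mul_of_nonneg_left hN (inv_pos.2 (hpos _)).le)
      rw [inv_mul_eq_div, le_div_iff₀ (hpos _)] at h1 h2
      have h3 : q * L ≤ 0 := mul_nonpos_of_nonneg_of_nonpos hq hL.le
      have h4 := mul_le_mul_of_nonneg_left (add_le_add h1 (mul_le_mul_of_nonneg_left h2 hq))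
        (hpos k).le
      calc ((d : ℝ) * q + 1) * α * d ^ (M + k)
          = d ^ k * (α * d ^ M + q * (α * d ^ (M + 1))) := by ring
        _ ≤ d ^ k * (b M + q * L) := h4
        _ ≤ d ^ k * a M + q * L * (d ^ k - 1) := by rw [haM]; linarith
        _ ≤ a (M + k) := hstep k
    have hbdd' : ∀ n, ((d : ℝ) * q + 1) * α ≤ ((d : ℝ) ^ n)⁻¹ * a n := fun n =>
      (hbdd n).trans (anti a ha (Nat.le_add_left n M))
    have hlim := tendsto_atTop_ciInf (anti a ha) ⟨_, Set.forall_mem_range.2 hbdd'⟩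
    refine ⟨_, hlim, le_ciInf hbdd', ?_⟩
    refine ((anti a ha).le_of_tendsto hlim 0).trans ?_
    simp [hab 0 (by rwa [hb0]), hb0]

section

variable {p : ℕ} [Fact p.Prime]

theorem eval₂_coe_eq_coe_eval (t : ℤ_[p]) (x : Fin 2 → ℤ_[p])
    (P : MvPolynomial (Fin 2) (Polynomial ℤ_[p])) :
    MvPolynomial.eval₂ (Polynomial.eval₂RingHom PadicInt.Coe.ringHom (t : ℚ_[p]))
        (fun i => (x i : ℚ_[p])) P =
      (MvPolynomial.eval₂ (Polynomial.evalRingHom t) x P : ℤ_[p]) := by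
  have h := MvPolynomial.eval₂_comp_left PadicInt.Coe.ringHom (Polynomial.evalRingHom t) x P
  have hc : (PadicInt.Coe.ringHom (p := p)).comp (Polynomial.evalRingHom t) =
      Polynomial.eval₂RingHom PadicInt.Coe.ringHom (t : ℚ_[p]) := by
    refine Polynomial.ringHom_ext (fun a => ?_) ?_
    · simp only [RingHom.comp_apply, Polynomial.coe_evalRingHom, Polynomial.eval_C,
        Polynomial.coe_eval₂RingHom, Polynomial.eval₂_C]
    · simp only [RingHom.comp_apply, Polynomial.coe_evalRingHom, Polynomial.eval_X,
        Polynomial.coe_eval₂RingHom, Polynomial.eval₂_X]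
      rfl
  rw [hc] at h
  exact h.symm

/-- Evaluation at congruent parameters and points gives congruent values. -/
theorem dvd_eval₂_sub_eval₂ {R : Type*} [CommRing R] {σ : Type*} {t s r : R} {x y : σ → R}
    (hts : r ∣ t - s) (hxy : ∀ i, r ∣ x i - y i) (P : MvPolynomial σ (Polynomial R)) :
    r ∣ MvPolynomial.eval₂ (Polynomial.evalRingHom t) x P -
      MvPolynomial.eval₂ (Polynomial.evalRingHom s) y P := by
  have key : ∀ a b : R, r ∣ a - b ↔
      Ideal.Quotient.mk (Ideal.span {r}) a = Ideal.Quotient.mk (Ideal.span {r}) b := fun a b => by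
    rw [Ideal.Quotient.mk_eq_mk_iff_sub_mem, Ideal.mem_span_singleton]
  rw [key, MvPolynomial.eval₂_comp_left, MvPolynomial.eval₂_comp_left]
  congr 1
  · refine Polynomial.ringHom_ext (fun a => by simp) ?_
    simpa using (key _ _).1 hts
  · exact funext fun i => (key _ _).1 (hxy i)

/-- A form of degree `d` with integral coefficients satisfies `|P_t(x)| ≤ ‖x‖ ^ d`. -/
theorem norm_eval₂_le_pow {d : ℕ} {P : MvPolynomial (Fin 2) (Polynomial ℤ_[p])}
    (hP : P.IsHomogeneous d) (t : ℤ_[p]) (x : Fin 2 → ℚ_[p]) :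
    ‖MvPolynomial.eval₂ (Polynomial.eval₂RingHom PadicInt.Coe.ringHom (t : ℚ_[p])) x P‖ ≤
      (max ‖x 0‖ ‖x 1‖) ^ d := by
  rw [MvPolynomial.eval₂_eq']
  refine IsUltrametricDist.norm_sum_le_of_forall_le_of_nonneg (by positivity) fun m hm => ?_
  have hdeg : m 0 + m 1 = d := by
    rw [← Fin.sum_univ_two, ← Finsupp.degree_eq_sum]
    exact (hP.degree_eq_sum_deg_support hm).symm
  have hcoeff : ‖Polynomial.eval₂RingHom PadicInt.Coe.ringHom (t : ℚ_[p]) (P.coeff m)‖ ≤ 1 := by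
    have : Polynomial.eval₂RingHom PadicInt.Coe.ringHom (t : ℚ_[p]) (P.coeff m) =
        ((P.coeff m).eval t : ℤ_[p]) :=
      Polynomial.eval₂_at_apply PadicInt.Coe.ringHom t
    rw [this]
    exact PadicInt.norm_le_one _
  rw [norm_mul, Fin.prod_univ_two, norm_mul, norm_pow, norm_pow, ← hdeg, pow_add]
  refine (mul_le_of_le_one_left (by positivity) hcoeff).trans ?_
  gcongr
  · exact le_max_left _ _
  · exact le_max_right _ _

theorem max_norm_le_max_of_dvd_sub {t : ℤ_[p]} {u v : Fin 2 → ℤ_[p]}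
    (h : ∀ i, t ∣ u i - v i) :
    max ‖u 0‖ ‖u 1‖ ≤ max (max ‖v 0‖ ‖v 1‖) ‖t‖ := by
  have hi : ∀ i, ‖u i‖ ≤ max ‖v i‖ ‖t‖ := fun i => by
    obtain ⟨c, hc⟩ := h i
    have hle : ‖t * c‖ ≤ ‖t‖ := by
      rw [norm_mul]
      exact mul_le_of_le_one_right (norm_nonneg _) c.norm_le_one
    rw [eq_add_of_sub_eq' hc]
    exact (PadicInt.nonarchimedean _ _).trans (max_le_max le_rfl hle)
  refine max_le ((hi 0).trans ?_) ((hi 1).trans ?_)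
  · exact max_le_max (le_max_left _ _) le_rfl
  · exact max_le_max (le_max_right _ _) le_rfl

theorem max_norm_eq_of_dvd_sub {t : ℤ_[p]} {u v : Fin 2 → ℤ_[p]}
    (h : ∀ i, t ∣ u i - v i) (ht : ‖t‖ < max ‖v 0‖ ‖v 1‖) :
    max ‖u 0‖ ‖u 1‖ = max ‖v 0‖ ‖v 1‖ := by
  refine le_antisymm ?_ ?_
  · simpa [max_eq_left ht.le] using max_norm_le_max_of_dvd_sub h
  · have := max_norm_le_max_of_dvd_sub fun i => (dvd_sub_comm.1 (h i))
    exact (le_max_iff.1 this).resolve_right (not_le.2 ht)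

theorem max_norm_pos_of_ne_zero {x : Fin 2 → ℚ_[p]} (hx : x ≠ 0) : 0 < max ‖x 0‖ ‖x 1‖ := by
  obtain ⟨i, hi⟩ := Function.ne_iff.1 hx
  refine lt_max_iff.2 ?_
  fin_cases i
  · exact Or.inl (norm_pos_iff.2 hi)
  · exact Or.inr (norm_pos_iff.2 hi)

theorem zpEval_coe (t : ℤ_[p]) (a : Polynomial ℤ_[p]) :
    zpEval p (t : ℚ_[p]) a = (a.eval t : ℤ_[p]) :=
  Polynomial.eval₂_at_apply PadicInt.Coe.ringHom t

end

/-- the summable lower bound `(dq+1)·α ≤ g(t) ≤ 0` on the disk `|t|_p < 1`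
for the escape-rate functions of a pair `(F, A)` with coefficients in `ℤ_p[t]`, where `F`
satisfies the resultant lower bound `|t|_p^q ‖x‖^d ≤ ‖F_t(x)‖`, the pair is hole-avoiding
at `t = 0`, `‖A(0)‖ = 1`, and `α = lim d^{-n} log ‖F₀ⁿ(A(0))‖`. -/
theorem stmt_15 (p : ℕ) [Fact p.Prime] (d q : ℕ) (hd : 2 ≤ d)
    (P Q : MvPolynomial (Fin 2) (Polynomial (PadicInt p)))
    (hP : P.IsHomogeneous d) (hQ : Q.IsHomogeneous d)
    (F : ℚ_[p] → (Fin 2 → ℚ_[p]) → (Fin 2 → ℚ_[p]))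
    (hF : ∀ (t : ℚ_[p]) (x : Fin 2 → ℚ_[p]),
      F t x = ![MvPolynomial.eval₂ (Polynomial.eval₂RingHom (PadicInt.Coe.ringHom) t) x P,
                MvPolynomial.eval₂ (Polynomial.eval₂RingHom (PadicInt.Coe.ringHom) t) x Q])
    (hlow : ∀ t : ℚ_[p], 0 < ‖t‖ → ‖t‖ < 1 → ∀ x : Fin 2 → ℚ_[p],
      ‖t‖ ^ q * (max ‖x 0‖ ‖x 1‖) ^ d ≤ max ‖F t x 0‖ ‖F t x 1‖)
    (A : Fin 2 → Polynomial (PadicInt p))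
    (hA0 : max ‖zpEval p 0 (A 0)‖ ‖zpEval p 0 (A 1)‖ = 1)
    (hhole : ∀ n : ℕ, (F 0)^[n] (fun i => zpEval p 0 (A i)) ≠ 0)
    (α : ℝ)
    (hα : Tendsto (fun n : ℕ => ((d : ℝ) ^ n)⁻¹ *
        Real.log (max ‖((F 0)^[n] (fun i => zpEval p 0 (A i))) 0‖
                      ‖((F 0)^[n] (fun i => zpEval p 0 (A i))) 1‖))
      atTop (𝓝 α)) :
    ∀ t : ℚ_[p], ‖t‖ < 1 →
      ∃ g : ℝ,
        Tendsto (fun n : ℕ => ((d : ℝ) ^ n)⁻¹ *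
            Real.log (max ‖((F t)^[n] (fun i => zpEval p t (A i))) 0‖
                          ‖((F t)^[n] (fun i => zpEval p t (A i))) 1‖))
          atTop (𝓝 g) ∧
        ((d : ℝ) * q + 1) * α ≤ g ∧ g ≤ 0 := by
  have hupper : ∀ (s : ℤ_[p]) (x : Fin 2 → ℚ_[p]),
      max ‖F s x 0‖ ‖F s x 1‖ ≤ (max ‖x 0‖ ‖x 1‖) ^ d := fun s x => by
    rw [hF]
    exact max_le (norm_eval₂_le_pow hP s x) (norm_eval₂_le_pow hQ s x)
  have hlog : ∀ (s : ℤ_[p]) (x : Fin 2 → ℚ_[p]), F s x ≠ 0 →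
      Real.log (max ‖F s x 0‖ ‖F s x 1‖) ≤ d * Real.log (max ‖x 0‖ ‖x 1‖) := fun s x h => by
    rw [← Real.log_pow]
    exact Real.log_le_log (max_norm_pos_of_ne_zero h) (hupper s x)
  have hb : ∀ n, Real.log (max ‖((F 0)^[n + 1] (fun i => zpEval p 0 (A i))) 0‖
        ‖((F 0)^[n + 1] (fun i => zpEval p 0 (A i))) 1‖) ≤
      d * Real.log (max ‖((F 0)^[n] (fun i => zpEval p 0 (A i))) 0‖
        ‖((F 0)^[n] (fun i => zpEval p 0 (A i))) 1‖) := fun n => by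
    have h := hhole (n + 1)
    rw [Function.iterate_succ_apply'] at h ⊢
    exact hlog 0 _ h
  intro t ht
  by_cases ht0 : t = 0
  · subst ht0
    have hα0 : α ≤ 0 := by
      refine le_of_tendsto' hα fun n => mul_nonpos_of_nonneg_of_nonpos (by positivity) ?_
      induction n with
      | zero => exact ((congrArg Real.log hA0).trans Real.log_one).le
      | succ n ih => exact (hb n).trans (mul_nonpos_of_nonneg_of_nonpos d.cast_nonneg ih)
    have hdq : (0 : ℝ) ≤ (d : ℝ) * q := by positivity
    exact ⟨α, hα, by linarith [mul_nonpos_of_nonneg_of_nonpos hdq hα0], hα0⟩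
  obtain ⟨t, rfl⟩ : ∃ s : ℤ_[p], (s : ℚ_[p]) = t := ⟨⟨t, ht.le⟩, rfl⟩
  have htpos : 0 < ‖(t : ℚ_[p])‖ := norm_pos_iff.2 ht0
  have horbit : ∀ n, ∃ u v : Fin 2 → ℤ_[p],
      (F t)^[n] (fun i => zpEval p t (A i)) = (fun i => (u i : ℚ_[p])) ∧
      (F 0)^[n] (fun i => zpEval p 0 (A i)) = (fun i => (v i : ℚ_[p])) ∧
      ∀ i, t ∣ u i - v i := by
    have hFcoe : ∀ (s : ℤ_[p]) (u : Fin 2 → ℤ_[p]), F s (fun i => (u i : ℚ_[p])) =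
        fun i => ((MvPolynomial.eval₂ (Polynomial.evalRingHom s) u (![P, Q] i) : ℤ_[p]) :
          ℚ_[p]) := fun s u => by
      rw [hF]
      ext i
      fin_cases i
      · exact eval₂_coe_eq_coe_eval s u P
      · exact eval₂_coe_eq_coe_eval s u Q
    intro n
    induction n with
    | zero =>
      refine ⟨fun i => (A i).eval t, fun i => (A i).eval 0, ?_, ?_, fun i => ?_⟩
      · exact funext fun i => zpEval_coe t (A i)
      · exact funext fun i => zpEval_coe 0 (A i)
      · simpa using Polynomial.sub_dvd_eval_sub t 0 (A i)
    | succ n ih =>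
      obtain ⟨u, v, hu, hv, huv⟩ := ih
      refine ⟨_, _, ?_, ?_, fun i => dvd_eval₂_sub_eval₂ (t := t) (s := 0) (by simp) huv
        (![P, Q] i)⟩
      · rw [Function.iterate_succ_apply', hu, hFcoe]
      · rw [Function.iterate_succ_apply', hv]
        exact hFcoe 0 v
  have heq : ∀ n, ‖(t : ℚ_[p])‖ < max ‖((F 0)^[n] (fun i => zpEval p 0 (A i))) 0‖
        ‖((F 0)^[n] (fun i => zpEval p 0 (A i))) 1‖ →
      max ‖((F t)^[n] (fun i => zpEval p t (A i))) 0‖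
        ‖((F t)^[n] (fun i => zpEval p t (A i))) 1‖ =
      max ‖((F 0)^[n] (fun i => zpEval p 0 (A i))) 0‖
        ‖((F 0)^[n] (fun i => zpEval p 0 (A i))) 1‖ := fun n hn => by
    obtain ⟨u, v, hu, hv, huv⟩ := horbit n
    rw [hv] at hn
    rw [hu, hv]
    exact max_norm_eq_of_dvd_sub huv hn
  have hpos : ∀ n, 0 < max ‖((F t)^[n] (fun i => zpEval p t (A i))) 0‖
      ‖((F t)^[n] (fun i => zpEval p t (A i))) 1‖ := by
    intro n
    induction n with
    | zero =>
      have h0 : max ‖zpEval p t (A 0)‖ ‖zpEval p t (A 1)‖ = 1 :=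
        (heq 0 (ht.trans_eq hA0.symm)).trans hA0
      exact one_pos.trans_eq h0.symm
    | succ n ih =>
      rw [Function.iterate_succ_apply']
      exact (mul_pos (pow_pos htpos q) (pow_pos ih d)).trans_le (hlow t htpos ht _)
  refine exists_tendsto_and_le_of_eq_of_lt hd (Real.log_neg htpos ht) ?_ (fun n => ?_) hb
    (fun n => ?_) (fun n hn => ?_) hα
  · exact (congrArg Real.log hA0).trans Real.log_one
  · have h := hpos (n + 1)
    rw [Function.iterate_succ_apply'] at h ⊢
    exact hlog t _ fun h0 => by simp [h0] at h
  · rw [Function.iterate_succ_apply', ← Real.log_pow, ← Real.log_pow,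
      ← Real.log_mul (pow_pos htpos q).ne' (pow_pos (hpos n) d).ne']
    exact Real.log_le_log (mul_pos (pow_pos htpos q) (pow_pos (hpos n) d)) (hlow t htpos ht _)
  · rw [heq n ((Real.log_lt_log_iff htpos (max_norm_pos_of_ne_zero (hhole n))).1 hn)]
end
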